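/- Let C ⊂ ℝ^d be a polyhedral convex cone, A a conic Borel set, and k ∈ {1, …, d}. Then ∫_{𝕊^{d−1}} Φ_k(C ∩ u⁻, A) σ(du) = (1/2) Φ_k(C, A) + (1/2) Φ_{k+1}(C, A), where u⁻ = {x ∈ ℝ^d : ⟨x,u⟩ ≤ 0}, σ is the normalized spherical Lebesgue measure on 𝕊^{d−1}, and Φ_{d+1}(C,A) := 0. -/

import Mathlib

open MeasureTheory Set
open scoped ENNReal RealInnerProductSpace Pointwise

noncomputable section

/-- Abbreviation for Euclidean space `ℝ^d`. -/
abbrev Euc (d : ℕ) := EuclideanSpace ℝ (Fin d)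

/-- The rotation group `SO(d)`, as a subgroup of the orthogonal group. -/
def SOG (d : ℕ) : Subgroup (Matrix.orthogonalGroup (Fin d) ℝ) where
  carrier := {A | (A : Matrix (Fin d) (Fin d) ℝ).det = 1}
  one_mem' := Matrix.det_one
  mul_mem' := by
    intro a b ha hb
    simp only [Set.mem_setOf_eq] at *
    rw [show ((a * b : Matrix.orthogonalGroup (Fin d) ℝ) : Matrix (Fin d) (Fin d) ℝ)
        = (a : Matrix (Fin d) (Fin d) ℝ) * (b : Matrix (Fin d) (Fin d) ℝ) from rfl,
      Matrix.det_mul, ha, hb, mul_one]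
  inv_mem' := by
    intro a ha
    simp only [Set.mem_setOf_eq] at *
    rw [show ((a⁻¹ : Matrix.orthogonalGroup (Fin d) ℝ) : Matrix (Fin d) (Fin d) ℝ)
        = star (a : Matrix (Fin d) (Fin d) ℝ) from rfl]
    rw [Matrix.star_eq_conjTranspose, Matrix.det_conjTranspose, ha, star_one]

instance (d : ℕ) : MeasurableSpace (SOG d) := borel _

/-- A rotation `ϑ ∈ SO(d)`, as a linear map on `ℝ^d`. -/
def rotLin {d : ℕ} (ϑ : SOG d) : Euc d →ₗ[ℝ] Euc d :=
  ((EuclideanSpace.equiv (Fin d) ℝ).symm.toLinearEquiv.toLinearMap.comp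
    (Matrix.mulVecLin (ϑ : Matrix (Fin d) (Fin d) ℝ))).comp
    (EuclideanSpace.equiv (Fin d) ℝ).toLinearEquiv.toLinearMap

/-- The action of a rotation `ϑ ∈ SO(d)` on `ℝ^d`. -/
def rot {d : ℕ} (ϑ : SOG d) : Euc d → Euc d := rotLin ϑ

variable {d : ℕ}

/-- The standard Gaussian probability measure `γ_d` on `ℝ^d`. -/
def stdGauss (d : ℕ) : Measure (Euc d) :=
  volume.withDensity fun x =>
    ENNReal.ofReal ((2 * Real.pi) ^ (-(d : ℝ) / 2) * Real.exp (-‖x‖ ^ 2 / 2))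

/-- The standard Gaussian measure `γ_L` of a linear subspace `L` of `ℝ^d`, viewed as a measure
on `ℝ^d` concentrated on `L`. -/
def gauss (L : Submodule ℝ (Euc d)) : Measure (Euc d) :=
  Measure.map (Subtype.val) <|
    (volume : Measure L).withDensity fun x =>
      ENNReal.ofReal ((2 * Real.pi) ^ (-(Module.finrank ℝ L : ℝ) / 2) *
        Real.exp (-‖(x : Euc d)‖ ^ 2 / 2))

/-- A set is conic if it is stable under multiplication by positive scalars. -/
def IsConic (A : Set (Euc d)) : Prop := ∀ a ∈ A, ∀ r : ℝ, 0 < r → r • a ∈ A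

/-- A polyhedral (convex) cone: an intersection of finitely many closed halfspaces bounded by
linear hyperplanes (the empty intersection being all of `ℝ^d`). -/
def IsPolyCone (C : Set (Euc d)) : Prop :=
  ∃ U : Finset (Euc d), C = ⋂ u ∈ U, {x | ⟪u, x⟫ ≤ 0}

/-- `F` is a face of the convex set `C`: a nonempty convex extreme subset. -/
def IsFace (C F : Set (Euc d)) : Prop := IsExtreme ℝ C F ∧ Convex ℝ F ∧ F.Nonempty

/-- The linear hull `L(F)` of a set `F`. -/
def linHull (F : Set (Euc d)) : Submodule ℝ (Euc d) := Submodule.span ℝ F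

/-- The dimension of a face (or cone) `F`, i.e. the dimension of its linear hull. -/
def dimS (F : Set (Euc d)) : ℕ := Module.finrank ℝ (linHull F)

/-- `F` is a `k`-dimensional face of `C`. -/
def IsFaceDim (C F : Set (Euc d)) (k : ℕ) : Prop := IsFace C F ∧ dimS F = k

/-- The normal cone `N(C,F)` of the cone `C` at its face `F`. -/
def normalCone (C F : Set (Euc d)) : Set (Euc d) :=
  {u | (∀ y ∈ C, ⟪u, y⟫ ≤ 0) ∧ ∀ x ∈ F, ⟪u, x⟫ = 0}

/-- The conic curvature measure `Φ_k(C, A)` of a polyhedral cone `C`, evaluated at `A`: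
`Φ_k(C,A) = ∑_{F ∈ 𝓕_k(C)} γ_{L(F)}(F ∩ A) ⬝ γ_{L(F)^⊥}(N(C,F))`. -/
def Phi (k : ℕ) (C A : Set (Euc d)) : ℝ≥0∞ :=
  ∑' F : {F : Set (Euc d) // IsFaceDim C F k},
    gauss (linHull F.1) (F.1 ∩ A) * gauss (linHull F.1)ᗮ (normalCone C F.1)

/-- The conic intrinsic volume `V_k(C) = ∑_{F ∈ 𝓕_k(C)} γ_d(F + N(C,F))`. -/
def cV (k : ℕ) (C : Set (Euc d)) : ℝ≥0∞ :=
  ∑' F : {F : Set (Euc d) // IsFaceDim C F k},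
    stdGauss d (F.1 + normalCone C F.1)

/-- The localization `φ_F(C,A) = γ_d((A ∩ F) + N(C,F))` of `v_F(C)`. -/
def phiLoc (C F A : Set (Euc d)) : ℝ≥0∞ := stdGauss d ((A ∩ F) + normalCone C F)

/-- `C` is (the underlying set of) a linear subspace of `ℝ^d`. -/
def IsLinSubspace (C : Set (Euc d)) : Prop := ∃ L : Submodule ℝ (Euc d), (L : Set (Euc d)) = C

/-- Two polyhedral cones intersect transversely: `dim (F ∩ G) = dim F + dim G − d` and the
relative interiors meet. -/
def Transverse (F G : Set (Euc d)) : Prop :=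
  (dimS (F ∩ G) : ℤ) = (dimS F : ℤ) + (dimS G : ℤ) - d ∧
    (intrinsicInterior ℝ F ∩ intrinsicInterior ℝ G).Nonempty

/-- The volume of the parallelepiped spanned by the union of orthonormal bases of `L₁` and `L₂`
(the square root of the Gram determinant of the combined family). -/
def gramVol (L₁ L₂ : Submodule ℝ (Euc d)) : ℝ :=
  Real.sqrt (Matrix.det (Matrix.of fun i j :
      Fin (Module.finrank ℝ L₁) ⊕ Fin (Module.finrank ℝ L₂) =>
    ⟪Sum.elim (fun a => ((stdOrthonormalBasis ℝ L₁) a : Euc d))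
        (fun b => ((stdOrthonormalBasis ℝ L₂) b : Euc d)) i,
      Sum.elim (fun a => ((stdOrthonormalBasis ℝ L₁) a : Euc d))
        (fun b => ((stdOrthonormalBasis ℝ L₂) b : Euc d)) j⟫))

/-- The generalized sine function `[L₁, L₂]` of two subspaces. -/
def genSine (L₁ L₂ : Submodule ℝ (Euc d)) : ℝ :=
  if Module.finrank ℝ L₁ + Module.finrank ℝ L₂ ≤ d then gramVol L₁ L₂ else gramVol L₁ᗮ L₂ᗮ

/-- The generalized sine function `[C, D] = [L(C), L(D)]` of two cones. -/
def genSineC (C D : Set (Euc d)) : ℝ := genSine (linHull C) (linHull D)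

/-- Spherical Lebesgue measure `σ_{d-1}` on the unit sphere of `ℝ^d`. -/
def sphLebesgue (d : ℕ) : Measure (Metric.sphere (0 : Euc d) 1) :=
  (volume : Measure (Euc d)).toSphere

/-- The normalized spherical Lebesgue measure `σ = σ_{d-1}/ω_d` on the unit sphere. -/
def sphNormalized (d : ℕ) : Measure (Metric.sphere (0 : Euc d) 1) :=
  (sphLebesgue d Set.univ)⁻¹ • sphLebesgue d

/-- The Schläfli cones induced by the hyperplanes `(u i)^⊥`, `i = 1, …, n`: the closures of the
connected components of the complement of the union of the hyperplanes. -/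
def schlafliCones {n : ℕ} (u : Fin n → Euc d) : Set (Set (Euc d)) :=
  {C | ∃ x : Euc d, (∀ i, ⟪u i, x⟫ ≠ 0) ∧
    C = closure (connectedComponentIn {y : Euc d | ∀ i, ⟪u i, y⟫ ≠ 0} x)}

/-- `C(n,d) = 2 ∑_{r=0}^{d-1} binom(n-1, r)`, the number of Schläfli cones induced by `n`
hyperplanes in general position. -/
def schlafliCount (n d : ℕ) : ℕ := 2 * ∑ r ∈ Finset.range d, (n - 1).choose r

/-- The joint distribution `σ^n` of the unit normal vectors of `n` independent isotropic random
hyperplanes. -/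
def sphPi (d n : ℕ) : Measure (Fin n → Metric.sphere (0 : Euc d) 1) :=
  Measure.pi fun _ => sphNormalized d

end

lemma charFun_gauss {d : ℕ} (L : Submodule ℝ (Euc d)) (t : Euc d) :
    charFun (gauss L) t = Complex.exp (-‖L.starProjection t‖ ^ 2 / 2) := by
  have hpi : (0 : ℝ) < 2 * Real.pi := by positivity
  rw [charFun_apply, gauss, integral_map (by fun_prop) (by fun_prop),
    integral_withDensity_eq_integral_toReal_smul (by fun_prop)
      (Filter.Eventually.of_forall fun _ => ENNReal.ofReal_lt_top)]
  have key := GaussianFourier.integral_cexp_neg_mul_sq_norm_add (V := L) (b := 1 / 2)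
    (by norm_num) Complex.I (L.orthogonalProjectionOnto t)
  have hint : ∀ x : L, (ENNReal.ofReal ((2 * Real.pi) ^ (-(Module.finrank ℝ L : ℝ) / 2) *
        Real.exp (-‖(x : Euc d)‖ ^ 2 / 2))).toReal • Complex.exp (⟪(x : Euc d), t⟫ * Complex.I)
      = ((2 * Real.pi) ^ (-(Module.finrank ℝ L : ℝ) / 2) : ℝ) *
        Complex.exp (-(1 / 2) * ‖x‖ ^ 2 + Complex.I * ⟪L.orthogonalProjectionOnto t, x⟫) := by
    intro x
    rw [ENNReal.toReal_ofReal (by positivity), Complex.real_smul, Complex.exp_add,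
      Submodule.inner_orthogonalProjectionOnto_eq_of_mem_right, real_inner_comm t]
    push_cast
    rw [Submodule.coe_norm]
    ring_nf
  simp_rw [hint]
  rw [integral_const_mul, key, ← mul_assoc]
  have h1 : (((2 * Real.pi) ^ (-(Module.finrank ℝ L : ℝ) / 2) : ℝ) : ℂ) *
      (Real.pi / (1 / 2) : ℂ) ^ ((Module.finrank ℝ L : ℂ) / 2) = 1 := by
    have : (Real.pi / (1 / 2) : ℂ) ^ ((Module.finrank ℝ L : ℂ) / 2) =
        (((2 * Real.pi) ^ ((Module.finrank ℝ L : ℝ) / 2) : ℝ) : ℂ) := by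
      rw [Complex.ofReal_cpow hpi.le]
      push_cast
      ring_nf
    rw [this, ← Complex.ofReal_mul, ← Real.rpow_add hpi]
    ring_nf
    simp
  rw [h1, one_mul, Submodule.starProjection_apply, Submodule.coe_norm]
  congr 1
  rw [Complex.I_sq]
  ring

instance isProbabilityMeasure_gauss {d : ℕ} (L : Submodule ℝ (Euc d)) :
    IsProbabilityMeasure (gauss L) := by
  have h : charFun (gauss L) 0 = 1 := by
    rw [charFun_gauss]; simp
  rw [charFun_zero] at h
  refine ⟨?_⟩
  have h' : (gauss L).real univ = 1 := by exact_mod_cast h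
  rw [measureReal_def] at h'
  exact (ENNReal.toReal_eq_one_iff _).1 h'

lemma gauss_compl_self {d : ℕ} (L : Submodule ℝ (Euc d)) : gauss L (L : Set (Euc d))ᶜ = 0 := by
  rw [gauss, Measure.map_apply (by fun_prop) L.closed_of_finiteDimensional.measurableSet.compl]
  have h : (Subtype.val : L → Euc d) ⁻¹' (L : Set (Euc d))ᶜ = ∅ := by ext x; simp
  rw [h, measure_empty]

lemma ae_mem_gauss {d : ℕ} (L : Submodule ℝ (Euc d)) : ∀ᵐ x ∂gauss L, x ∈ L :=
  gauss_compl_self L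

lemma gauss_submodule_eq_zero {d : ℕ} {L M : Submodule ℝ (Euc d)} (h : ¬ L ≤ M) :
    gauss L (M : Set (Euc d)) = 0 := by
  rw [gauss, Measure.map_apply (by fun_prop) M.closed_of_finiteDimensional.measurableSet]
  refine withDensity_absolutelyContinuous _ _ ?_
  refine Measure.addHaar_submodule volume (M.comap L.subtype) fun ht => h fun x hx => ?_
  have : (⟨x, hx⟩ : L) ∈ M.comap L.subtype := ht ▸ Submodule.mem_top
  simpa using this

lemma ae_notMem_gauss {d : ℕ} {L M : Submodule ℝ (Euc d)} (h : ¬ L ≤ M) :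
    ∀ᵐ x ∂gauss L, x ∉ M := by
  rw [ae_iff]
  simpa using gauss_submodule_eq_zero h

lemma charFun_map_of_inner_eq {d : ℕ} (μ : Measure (Euc d)) (T S : Euc d → Euc d)
    (hT : Measurable T) (hTS : ∀ x y, ⟪T x, y⟫ = ⟪x, S y⟫) (t : Euc d) :
    charFun (μ.map T) t = charFun μ (S t) := by
  rw [charFun_apply, charFun_apply, integral_map hT.aemeasurable (by fun_prop)]
  simp_rw [hTS]

lemma map_starProjection_gauss_top {d : ℕ} (L : Submodule ℝ (Euc d)) :
    (gauss ⊤).map L.starProjection = gauss L := by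
  have := Measure.isProbabilityMeasure_map (μ := gauss (⊤ : Submodule ℝ (Euc d)))
    (f := L.starProjection) (by fun_prop)
  refine Measure.ext_of_charFun (funext fun t => ?_)
  rw [charFun_map_of_inner_eq _ _ L.starProjection (by fun_prop)
    (fun x y => L.inner_starProjection_left_eq_right x y), charFun_gauss, charFun_gauss]
  rw [Submodule.starProjection_top, ContinuousLinearMap.id_apply]

lemma map_add_gauss_prod {d : ℕ} (L : Submodule ℝ (Euc d)) :
    ((gauss L).prod (gauss Lᗮ)).map (fun x => x.1 + x.2) = gauss ⊤ := by
  have := Measure.isProbabilityMeasure_map (μ := (gauss L).prod (gauss Lᗮ))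
    (f := fun x => x.1 + x.2) (by fun_prop)
  refine Measure.ext_of_charFun (funext fun t => ?_)
  have := charFun_conv (μ := gauss L) (ν := gauss Lᗮ) t
  rw [Measure.conv] at this
  rw [this, charFun_gauss, charFun_gauss, charFun_gauss, ← Complex.exp_add]
  have h := L.norm_sq_eq_add_norm_sq_starProjection t
  congr 1
  simp only [Submodule.starProjection_top, ContinuousLinearMap.id_apply]
  have h' : ((‖t‖ : ℂ)) ^ 2 = ‖L.starProjection t‖ ^ 2 + ‖Lᗮ.starProjection t‖ ^ 2 := by
    exact_mod_cast h
  rw [h']; ring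

lemma map_reflection_gauss {d : ℕ} (L : Submodule ℝ (Euc d)) {v : Euc d} (hv : v ∈ L) :
    (gauss L).map (ℝ ∙ v)ᗮ.reflection = gauss L := by
  have := Measure.isProbabilityMeasure_map (μ := gauss L)
    (f := (ℝ ∙ v)ᗮ.reflection) (by fun_prop)
  refine Measure.ext_of_charFun (funext fun t => ?_)
  rw [charFun_map_of_inner_eq _ _ (ℝ ∙ v)ᗮ.reflection (by fun_prop) (fun x y => by
    rw [LinearIsometryEquiv.inner_map_eq_flip, Submodule.reflection_symm]), charFun_gauss,
    charFun_gauss]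
  have hc : L.starProjection ((ℝ ∙ v)ᗮ.reflection t) =
      (ℝ ∙ v)ᗮ.reflection (L.starProjection t) := by
    rw [Submodule.reflection_orthogonal_apply, Submodule.reflection_orthogonal_apply,
      Submodule.reflection_singleton_apply, Submodule.reflection_singleton_apply]
    have h1 : ⟪v, L.starProjection t⟫ = ⟪v, t⟫ := by
      rw [← L.inner_starProjection_left_eq_right, Submodule.starProjection_eq_self_iff.2 hv]
    rw [h1]
    simp [Submodule.starProjection_eq_self_iff.2 hv]
  rw [hc, LinearIsometryEquiv.norm_map]

/-- A Borel measure on `ℝ^d` that lives on `L ∖ {0}` and is invariant under the orthogonal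
reflections of `L`. -/
structure IsRotInvariantOn {d : ℕ} (L : Submodule ℝ (Euc d)) (μ : Measure (Euc d)) : Prop where
  ae_mem : ∀ᵐ x ∂μ, x ∈ L
  ae_ne_zero : ∀ᵐ x ∂μ, x ≠ 0
  map_reflection : ∀ v ∈ L, μ.map (ℝ ∙ v)ᗮ.reflection = μ

lemma charFun_starProjection {d : ℕ} {L : Submodule ℝ (Euc d)} {μ : Measure (Euc d)}
    (hμ : ∀ᵐ x ∂μ, x ∈ L) (t : Euc d) : charFun μ (L.starProjection t) = charFun μ t := by
  rw [charFun_apply, charFun_apply]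
  refine integral_congr_ae (hμ.mono fun x hx => ?_)
  simp only
  rw [← L.inner_starProjection_left_eq_right, Submodule.starProjection_eq_self_iff.2 hx]

lemma IsRotInvariantOn.charFun_eq_of_norm_eq {d : ℕ} {L : Submodule ℝ (Euc d)}
    {μ : Measure (Euc d)} (hμ : IsRotInvariantOn L μ) {x y : Euc d} (hx : x ∈ L) (hy : y ∈ L)
    (hxy : ‖x‖ = ‖y‖) : charFun μ x = charFun μ y := by
  have h := charFun_map_of_inner_eq μ (ℝ ∙ (x - y))ᗮ.reflection (ℝ ∙ (x - y))ᗮ.reflection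
    (by fun_prop) (fun x y => by rw [LinearIsometryEquiv.inner_map_eq_flip, Submodule.reflection_symm]) x
  rw [hμ.map_reflection _ (L.sub_mem hx hy), Submodule.reflection_sub hxy] at h
  exact h

lemma IsRotInvariantOn.map_normalize {d : ℕ} {L : Submodule ℝ (Euc d)}
    {μ : Measure (Euc d)} (hμ : IsRotInvariantOn L μ) :
    IsRotInvariantOn L (μ.map fun x => ‖x‖⁻¹ • x) := by
  refine ⟨?_, ?_, fun v hv => ?_⟩
  · refine (ae_map_iff (p := fun x => x ∈ L) (by fun_prop)
      L.closed_of_finiteDimensional.measurableSet).2 ?_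
    exact hμ.ae_mem.mono fun x hx => L.smul_mem _ hx
  · refine (ae_map_iff (p := fun x => x ≠ 0) (by fun_prop) (measurableSet_singleton 0).compl).2 ?_
    exact hμ.ae_ne_zero.mono fun x hx => by simp [hx]
  · conv_rhs => rw [← hμ.map_reflection v hv]
    rw [Measure.map_map (by fun_prop) (by fun_prop), Measure.map_map (by fun_prop) (by fun_prop)]
    congr 1
    ext1 x
    simp

lemma IsRotInvariantOn.eq_of_norm_eq_one {d : ℕ} {L : Submodule ℝ (Euc d)}
    {μ ν : Measure (Euc d)} [IsProbabilityMeasure μ] [IsProbabilityMeasure ν]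
    (hμ : IsRotInvariantOn L μ) (hν : IsRotInvariantOn L ν)
    (hμ1 : ∀ᵐ x ∂μ, ‖x‖ = 1) (hν1 : ∀ᵐ x ∂ν, ‖x‖ = 1) : μ = ν := by
  refine Measure.ext_of_charFun (funext fun t => ?_)
  rw [← charFun_starProjection hμ.ae_mem, ← charFun_starProjection hν.ae_mem]
  set s := L.starProjection t with hs
  have hsL : s ∈ L := L.starProjection_apply_mem t
  have average : ∀ {μ ν : Measure (Euc d)} [IsProbabilityMeasure μ] [IsProbabilityMeasure ν],
      IsRotInvariantOn L μ → IsRotInvariantOn L ν → (∀ᵐ x ∂ν, ‖x‖ = 1) →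
      charFun μ s = ∫ y, ∫ x, Complex.exp (⟪x, ‖s‖ • y⟫ * Complex.I) ∂μ ∂ν := by
    intro μ ν _ _ hμ hν hν1
    have h : ∀ᵐ y ∂ν, charFun μ (‖s‖ • y) = charFun μ s := by
      filter_upwards [hν.ae_mem, hν1] with y hy hy1
      exact hμ.charFun_eq_of_norm_eq (L.smul_mem _ hy) hsL (by simp [norm_smul, hy1])
    simp_rw [← charFun_apply]
    rw [integral_congr_ae h]
    simp
  rw [average hμ hν hν1, average hν hμ hμ1, integral_integral_swap]
  · simp_rw [real_inner_smul_right, real_inner_comm]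
  · refine Integrable.of_bound (C := 1) (Measurable.aestronglyMeasurable ?_)
      (Filter.Eventually.of_forall fun x => ?_)
    · simp only [Function.uncurry_def]; fun_prop
    · simp only [Function.uncurry_def]
      rw [Complex.norm_exp_ofReal_mul_I]

lemma IsRotInvariantOn.map_normalize_eq {d : ℕ} {L : Submodule ℝ (Euc d)}
    {μ ν : Measure (Euc d)} [IsProbabilityMeasure μ] [IsProbabilityMeasure ν]
    (hμ : IsRotInvariantOn L μ) (hν : IsRotInvariantOn L ν) :
    (μ.map fun x => ‖x‖⁻¹ • x) = ν.map fun x => ‖x‖⁻¹ • x := by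
  have norm_one : ∀ {μ : Measure (Euc d)}, IsRotInvariantOn L μ →
      ∀ᵐ x ∂(μ.map fun x => ‖x‖⁻¹ • x), ‖x‖ = 1 := by
    intro μ hμ
    rw [ae_map_iff (by fun_prop) (measurableSet_eq_fun (by fun_prop) (by fun_prop))]
    exact hμ.ae_ne_zero.mono fun x hx => by simp [norm_smul, hx]
  have := Measure.isProbabilityMeasure_map (μ := μ) (f := fun x => ‖x‖⁻¹ • x) (by fun_prop)
  have := Measure.isProbabilityMeasure_map (μ := ν) (f := fun x => ‖x‖⁻¹ • x) (by fun_prop)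
  exact hμ.map_normalize.eq_of_norm_eq_one hν.map_normalize (norm_one hμ) (norm_one hν)

lemma IsRotInvariantOn.lintegral_eq {d : ℕ} {L : Submodule ℝ (Euc d)}
    {μ ν : Measure (Euc d)} [IsProbabilityMeasure μ] [IsProbabilityMeasure ν]
    (hμ : IsRotInvariantOn L μ) (hν : IsRotInvariantOn L ν) {f : Euc d → ℝ≥0∞}
    (hf : Measurable f) (hfc : ∀ x, ∀ r : ℝ, 0 < r → f (r • x) = f x) :
    ∫⁻ x, f x ∂μ = ∫⁻ x, f x ∂ν := by
  have h : ∀ {μ : Measure (Euc d)}, IsRotInvariantOn L μ →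
      ∫⁻ x, f x ∂μ = ∫⁻ x, f x ∂(μ.map fun x => ‖x‖⁻¹ • x) := by
    intro μ hμ
    rw [lintegral_map hf (by fun_prop)]
    exact lintegral_congr_ae (hμ.ae_ne_zero.mono fun x hx =>
      (hfc x _ (inv_pos.2 (norm_pos_iff.2 hx))).symm)
  rw [h hμ, h hν, hμ.map_normalize_eq hν]

lemma IsConic.smul_mem_iff {d : ℕ} {A : Set (Euc d)} (hA : IsConic A) {r : ℝ} (hr : 0 < r)
    {x : Euc d} : r • x ∈ A ↔ x ∈ A := by
  refine ⟨fun h => ?_, fun h => hA x h r hr⟩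
  simpa [smul_smul, hr.ne'] using hA _ h r⁻¹ (inv_pos.2 hr)

lemma isRotInvariantOn_gauss {d : ℕ} {L : Submodule ℝ (Euc d)} (hL : L ≠ ⊥) :
    IsRotInvariantOn L (gauss L) :=
  ⟨ae_mem_gauss L, (ae_notMem_gauss (M := ⊥) (by simpa using hL)).mono fun x hx => by simpa using hx,
    fun _ => map_reflection_gauss L⟩

lemma toSphere_preimage_val {d : ℕ} {B : Set (Euc d)} (hB : MeasurableSet B) :
    sphLebesgue d (Subtype.val ⁻¹' B) =
      d * volume (Ioo (0 : ℝ) 1 • (Metric.sphere (0 : Euc d) 1 ∩ B)) := by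
  rw [sphLebesgue, Measure.toSphere_apply' _ (hB.preimage measurable_subtype_coe),
    Subtype.image_preimage_coe]
  simp

instance isFiniteMeasure_sphLebesgue (d : ℕ) : IsFiniteMeasure (sphLebesgue d) := by
  unfold sphLebesgue; infer_instance

lemma isProbabilityMeasure_sphNormalized {d : ℕ} (hd : 1 ≤ d) :
    IsProbabilityMeasure (sphNormalized d) := by
  have : Nonempty (Fin d) := ⟨⟨0, hd⟩⟩
  refine ⟨?_⟩
  rw [sphNormalized, Measure.smul_apply, smul_eq_mul]
  refine ENNReal.inv_mul_cancel ?_ (measure_ne_top _ _)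
  rw [Ne, Measure.measure_univ_eq_zero]
  exact Measure.toSphere_ne_zero _

lemma isRotInvariantOn_map_sphNormalized (d : ℕ) :
    IsRotInvariantOn ⊤ ((sphNormalized d).map Subtype.val) := by
  refine ⟨by simp, ?_, fun v _ => ?_⟩
  · refine (ae_map_iff (p := fun x => x ≠ 0) (by fun_prop) (measurableSet_singleton 0).compl).2 ?_
    exact Filter.Eventually.of_forall fun x h => by
      have hx := x.2
      rw [mem_sphere_zero_iff_norm] at hx
      rw [h, norm_zero] at hx
      exact zero_ne_one hx
  · set ρ := (ℝ ∙ v)ᗮ.reflection with hρ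
    ext B hB
    have hρB : MeasurableSet (ρ ⁻¹' B) := hB.preimage (by fun_prop)
    rw [Measure.map_apply (by fun_prop) hB, Measure.map_apply (by fun_prop) hρB,
      Measure.map_apply (by fun_prop) hB, sphNormalized, Measure.smul_apply, Measure.smul_apply,
      toSphere_preimage_val hB, toSphere_preimage_val hρB]
    congr 2
    have h : Ioo (0 : ℝ) 1 • (Metric.sphere (0 : Euc d) 1 ∩ ρ ⁻¹' B) =
        ρ ⁻¹' (Ioo (0 : ℝ) 1 • (Metric.sphere (0 : Euc d) 1 ∩ B)) := by
      ext x
      simp only [Set.mem_smul, mem_inter_iff, mem_sphere_zero_iff_norm, mem_preimage]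
      constructor
      · rintro ⟨r, hr, y, ⟨hy, hyB⟩, rfl⟩
        exact ⟨r, hr, ρ y, ⟨by simpa using hy, hyB⟩, by simp⟩
      · rintro ⟨r, hr, y, ⟨hy, hyB⟩, hx⟩
        refine ⟨r, hr, ρ y, ⟨by simpa using hy, ?_⟩, ?_⟩
        · rwa [hρ, Submodule.reflection_reflection]
        · rw [← map_smul, hx, hρ, Submodule.reflection_reflection]
    rw [h]
    exact ρ.measurePreserving.measure_preimage_equiv (f := ρ.toMeasurableEquiv) _

lemma lintegral_sphNormalized {d : ℕ} (hd : 1 ≤ d) {f : Euc d → ℝ≥0∞}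
    (hf : Measurable f) (hfc : ∀ x, ∀ r : ℝ, 0 < r → f (r • x) = f x) :
    ∫⁻ u, f u ∂(sphNormalized d) = ∫⁻ u, f u ∂(gauss ⊤) := by
  have : Nonempty (Fin d) := ⟨⟨0, hd⟩⟩
  have := isProbabilityMeasure_sphNormalized hd
  have := Measure.isProbabilityMeasure_map (μ := sphNormalized d) (f := Subtype.val) (by fun_prop)
  rw [← (isRotInvariantOn_map_sphNormalized d).lintegral_eq
    (isRotInvariantOn_gauss top_ne_bot) hf hfc, lintegral_map hf (by fun_prop)]

lemma map_neg_gauss {d : ℕ} (L : Submodule ℝ (Euc d)) : (gauss L).map (fun x => -x) = gauss L := by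
  have := Measure.isProbabilityMeasure_map (μ := gauss L) (f := fun x => -x) (by fun_prop)
  refine Measure.ext_of_charFun (funext fun t => ?_)
  rw [charFun_map_of_inner_eq _ _ (fun x => -x) (by fun_prop) (by simp), charFun_gauss, charFun_gauss]
  simp

lemma gauss_halfspace {d : ℕ} {L : Submodule ℝ (Euc d)} {p : Euc d} (hp : p ∉ Lᗮ) :
    gauss L {x | ⟪x, p⟫ < 0} = 1 / 2 := by
  have hm : MeasurableSet {x : Euc d | ⟪x, p⟫ < 0} :=
    measurableSet_lt (by fun_prop) (by fun_prop)
  have h1 : gauss L {x | 0 < ⟪x, p⟫} = gauss L {x | ⟪x, p⟫ < 0} := by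
    conv_rhs => rw [← map_neg_gauss, Measure.map_apply (by fun_prop) hm]
    congr 1; ext x; simp
  have h0 : ∀ᵐ x ∂gauss L, ⟪x, p⟫ ≠ 0 := by
    refine (ae_notMem_gauss (M := (ℝ ∙ p)ᗮ) fun h => hp fun x hx => ?_).mono fun x hx h => hx ?_
    · rw [real_inner_comm]; exact Submodule.mem_orthogonal_singleton_iff_inner_right.1 (h hx)
    · rwa [Submodule.mem_orthogonal_singleton_iff_inner_left]
  have h2 : gauss L {x | 0 < ⟪x, p⟫} = gauss L {x | ⟪x, p⟫ < 0}ᶜ := by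
    refine measure_congr (h0.mono fun x hx => ?_)
    simp only [eq_iff_iff]
    change 0 < ⟪x, p⟫ ↔ ¬ (⟪x, p⟫ < 0)
    rw [not_lt]; exact ⟨le_of_lt, fun h => lt_of_le_of_ne h hx.symm⟩
  have h3 := measure_add_measure_compl (μ := gauss L) hm
  rw [← h2, h1, measure_univ, ← two_mul] at h3
  rw [ENNReal.eq_div_iff (by norm_num) (by norm_num), h3]

lemma gauss_closed_halfspace {d : ℕ} {L : Submodule ℝ (Euc d)} {p : Euc d} (hp : p ∉ Lᗮ) :
    gauss L {x | 0 ≤ ⟪x, p⟫} = 1 / 2 := by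
  have h : {x : Euc d | 0 ≤ ⟪x, p⟫} = {x | ⟪x, p⟫ < 0}ᶜ := by ext x; simp
  rw [h, prob_compl_eq_one_sub (measurableSet_lt (by fun_prop) (by fun_prop)),
    gauss_halfspace hp]
  simp

/-- The difference `x - s y` of independent Gaussian vectors is a multiple of a Gaussian vector,
so it hits a conic set with the same probability. -/
lemma gauss_prod_sub_smul_mem {d : ℕ} (L : Submodule ℝ (Euc d)) (s : ℝ) {N : Set (Euc d)}
    (hN : MeasurableSet N) (hNc : IsConic N) :
    ((gauss L).prod (gauss L)) {x | x.1 - s • x.2 ∈ N} = gauss L N := by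
  have key : ((gauss L).prod (gauss L)).map (fun x => x.1 - s • x.2) =
      (gauss L).map (fun x => √(1 + s ^ 2) • x) := by
    have := Measure.isProbabilityMeasure_map (μ := (gauss L).prod (gauss L))
      (f := fun x => x.1 - s • x.2) (by fun_prop)
    have := Measure.isProbabilityMeasure_map (μ := gauss L)
      (f := fun x => √(1 + s ^ 2) • x) (by fun_prop)
    refine Measure.ext_of_charFun (funext fun t => ?_)
    rw [charFun_map_smul, charFun_apply, integral_map (by fun_prop) (by fun_prop)]
    have h : ∀ x : Euc d × Euc d, Complex.exp (⟪x.1 - s • x.2, t⟫ * Complex.I) =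
        Complex.exp (⟪x.1, t⟫ * Complex.I) * Complex.exp (⟪x.2, (-s) • t⟫ * Complex.I) := by
      intro x
      rw [← Complex.exp_add, inner_sub_left, real_inner_smul_left, real_inner_smul_right]
      congr 1; push_cast; ring
    simp_rw [h]
    rw [integral_prod_mul (fun x : Euc d => Complex.exp (⟪x, t⟫ * Complex.I))
      (fun x : Euc d => Complex.exp (⟪x, (-s) • t⟫ * Complex.I)), ← charFun_apply, ← charFun_apply,
      charFun_gauss, charFun_gauss, charFun_gauss, ← Complex.exp_add]
    congr 1
    simp only [map_smul, norm_smul, mul_pow, Complex.ofReal_mul]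
    have h1 : ((‖√(1 + s ^ 2)‖ : ℝ) : ℂ) ^ 2 = 1 + s ^ 2 := by
      rw [← Complex.ofReal_pow, Real.norm_eq_abs, sq_abs, Real.sq_sqrt (by positivity)]
      push_cast; ring
    have h2 : ((‖-s‖ : ℝ) : ℂ) ^ 2 = s ^ 2 := by
      rw [← Complex.ofReal_pow, Real.norm_eq_abs, sq_abs]; push_cast; ring
    rw [h1, h2]; ring
  have h1 : {x : Euc d × Euc d | x.1 - s • x.2 ∈ N} = (fun x => x.1 - s • x.2) ⁻¹' N := rfl
  rw [h1, ← Measure.map_apply (by fun_prop) hN, key, Measure.map_apply (by fun_prop) hN]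
  congr 1
  ext x
  exact hNc.smul_mem_iff (by positivity)

/-- The component of `a` orthogonal to `p`. -/
noncomputable def rejection {d : ℕ} (p a : Euc d) : Euc d := a - (⟪a, p⟫ / ‖p‖ ^ 2) • p

@[fun_prop]
lemma measurable_rejection {d : ℕ} {α : Type*} [MeasurableSpace α] {f g : α → Euc d}
    (hf : Measurable f) (hg : Measurable g) : Measurable fun x => rejection (f x) (g x) := by
  unfold rejection; fun_prop

lemma starProjection_inf_orthogonal {d : ℕ} (L : Submodule ℝ (Euc d)) (u t : Euc d) :
    (L ⊓ (ℝ ∙ u)ᗮ).starProjection t = rejection (L.starProjection u) (L.starProjection t) := by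
  set p := L.starProjection u with hp
  have hpL : p ∈ L := L.starProjection_apply_mem u
  have hinner : ∀ w ∈ L, ⟪w, u⟫ = ⟪w, p⟫ := fun w hw => by
    rw [hp, ← L.inner_starProjection_left_eq_right, Submodule.starProjection_eq_self_iff.2 hw]
  have hmem : rejection p (L.starProjection t) ∈ L :=
    L.sub_mem (L.starProjection_apply_mem t) (L.smul_mem _ hpL)
  refine Submodule.eq_starProjection_of_mem_of_inner_eq_zero ⟨hmem, ?_⟩ fun w hw => ?_
  · rw [SetLike.mem_coe, Submodule.mem_orthogonal_singleton_iff_inner_left, hinner _ hmem, rejection,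
      inner_sub_left, real_inner_smul_left, real_inner_self_eq_norm_sq]
    rcases eq_or_ne p 0 with h | h
    · simp [h]
    · have : ‖p‖ ^ 2 ≠ 0 := by simpa using h
      field_simp
      ring
  · have hwp : ⟪p, w⟫ = 0 := by
      rw [real_inner_comm, ← hinner w hw.1]
      exact Submodule.mem_orthogonal_singleton_iff_inner_left.1 hw.2
    rw [rejection, sub_sub_eq_add_sub, inner_sub_left, inner_add_left, real_inner_smul_left, hwp,
      mul_zero, add_zero, ← inner_sub_left]
    exact L.starProjection_inner_eq_zero _ _ hw.1

lemma gauss_inf_orthogonal {d : ℕ} (L : Submodule ℝ (Euc d)) (u : Euc d) {B : Set (Euc d)}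
    (hB : MeasurableSet B) :
    gauss (L ⊓ (ℝ ∙ u)ᗮ) B = gauss L {a | rejection (L.starProjection u) a ∈ B} := by
  have hm : MeasurableSet {a | rejection (L.starProjection u) a ∈ B} :=
    hB.preimage (by fun_prop)
  rw [← map_starProjection_gauss_top, ← map_starProjection_gauss_top L,
    Measure.map_apply (by fun_prop) hB, Measure.map_apply (by fun_prop) hm]
  congr 1
  ext t
  simp only [mem_preimage, starProjection_inf_orthogonal]
  rfl

lemma mem_add_ray_iff {d : ℕ} {L : Submodule ℝ (Euc d)} {N : Set (Euc d)}
    (hNL : N ⊆ Lᗮ) {u : Euc d} (hu : u ∉ Lᗮ) (y : Euc d) :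
    (∃ n ∈ N, ∃ s : ℝ, 0 ≤ s ∧ n + s • u = y) ↔
      0 ≤ ⟪y, L.starProjection u⟫ ∧
      L.starProjection y = (⟪y, L.starProjection u⟫ / ‖L.starProjection u‖ ^ 2) •
        L.starProjection u ∧
      Lᗮ.starProjection y - (⟪y, L.starProjection u⟫ / ‖L.starProjection u‖ ^ 2) •
        Lᗮ.starProjection u ∈ N := by
  set p := L.starProjection u with hp
  have hp0 : p ≠ 0 := fun h => hu ((L.starProjection_apply_eq_zero_iff).1 h)
  have hpn : 0 < ‖p‖ ^ 2 := by positivity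
  have hpL : p ∈ L := L.starProjection_apply_mem u
  constructor
  · rintro ⟨n, hn, s, hs, rfl⟩
    have hn' := hNL hn
    have hPn : L.starProjection n = 0 := (L.starProjection_apply_eq_zero_iff).2 hn'
    have hQn : Lᗮ.starProjection n = n := Submodule.starProjection_eq_self_iff.2 hn'
    have hin : ⟪n + s • u, p⟫ = s * ‖p‖ ^ 2 := by
      rw [hp, ← L.inner_starProjection_left_eq_right, map_add, map_smul, hPn, ← hp,
        zero_add, real_inner_smul_left]
      congr 1
      rw [← Submodule.starProjection_eq_self_iff.2 hpL, L.inner_starProjection_left_eq_right,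
        Submodule.starProjection_eq_self_iff.2 hpL, ← hp, real_inner_self_eq_norm_sq]
    have hq : ⟪n + s • u, p⟫ / ‖p‖ ^ 2 = s := by rw [hin]; field_simp
    rw [hq, hin]
    refine ⟨by positivity, ?_, ?_⟩
    · rw [map_add, map_smul, hPn, zero_add]
    · rw [map_add, map_smul, hQn, add_sub_cancel_right]
      exact hn
  · rintro ⟨h0, h1, h2⟩
    refine ⟨_, h2, ⟪y, p⟫ / ‖p‖ ^ 2, by positivity, ?_⟩
    conv_rhs => rw [← L.starProjection_add_starProjection_orthogonal y, h1]
    have hcu : (⟪y, p⟫ / ‖p‖ ^ 2) • u = (⟪y, p⟫ / ‖p‖ ^ 2) • p +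
        (⟪y, p⟫ / ‖p‖ ^ 2) • Lᗮ.starProjection u := by
      rw [← smul_add, L.starProjection_add_starProjection_orthogonal u]
    rw [hcu]
    abel

lemma measurableSet_add_ray {d : ℕ} {L : Submodule ℝ (Euc d)} {N : Set (Euc d)}
    (hN : MeasurableSet N) (hNL : N ⊆ Lᗮ) {u : Euc d} (hu : u ∉ Lᗮ) :
    MeasurableSet {y | ∃ n ∈ N, ∃ s : ℝ, 0 ≤ s ∧ n + s • u = y} := by
  simp_rw [mem_add_ray_iff hNL hu]
  have h1 : MeasurableSet {y : Euc d | 0 ≤ ⟪y, L.starProjection u⟫} :=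
    measurableSet_le (by fun_prop) (by fun_prop)
  have h2 : MeasurableSet {y : Euc d | L.starProjection y =
      (⟪y, L.starProjection u⟫ / ‖L.starProjection u‖ ^ 2) • L.starProjection u} :=
    measurableSet_eq_fun (by fun_prop) (by fun_prop)
  have h3 : MeasurableSet {y : Euc d | Lᗮ.starProjection y -
      (⟪y, L.starProjection u⟫ / ‖L.starProjection u‖ ^ 2) • Lᗮ.starProjection u ∈ N} :=
    hN.preimage (by fun_prop)
  exact h1.inter (h2.inter h3)

/-- The probability that a Gaussian vector of `(L ⊓ u^⊥)^⊥` lies in `N + pos u`, where `p` and `q`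
are the components of `u` in `L` and `L^⊥`. -/
noncomputable def rayProb {d : ℕ} (L : Submodule ℝ (Euc d)) (N : Set (Euc d)) (p q : Euc d) :
    ℝ≥0∞ :=
  ∫⁻ a, {a | 0 ≤ ⟪a, p⟫}.indicator
    (fun a => gauss Lᗮ {b | b - (⟪a, p⟫ / ‖p‖ ^ 2) • q ∈ N}) a ∂(gauss L)

lemma gauss_inf_orthogonal_orthogonal {d : ℕ} {L : Submodule ℝ (Euc d)} {N : Set (Euc d)}
    (hN : MeasurableSet N) (hNL : N ⊆ Lᗮ) {u : Euc d} (hu : u ∉ Lᗮ) :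
    gauss (L ⊓ (ℝ ∙ u)ᗮ)ᗮ {y | ∃ n ∈ N, ∃ s : ℝ, 0 ≤ s ∧ n + s • u = y} =
      rayProb L N (L.starProjection u) (Lᗮ.starProjection u) := by
  set p := L.starProjection u with hp
  set q := Lᗮ.starProjection u with hq
  have hpL : p ∈ L := L.starProjection_apply_mem u
  have hp0 : p ≠ 0 := fun h => hu ((L.starProjection_apply_eq_zero_iff).1 h)
  have hpn : ‖p‖ ^ 2 ≠ 0 := by simpa using hp0
  have hm := measurableSet_add_ray hN hNL hu
  have hS : MeasurableSet {x : Euc d × Euc d |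
      0 ≤ ⟪x.1, p⟫ ∧ x.2 - (⟪x.1, p⟫ / ‖p‖ ^ 2) • q ∈ N} := by
    have h1 : MeasurableSet {x : Euc d × Euc d | 0 ≤ ⟪x.1, p⟫} :=
      measurableSet_le (by fun_prop) (by fun_prop)
    have h2 : MeasurableSet {x : Euc d × Euc d | x.2 - (⟪x.1, p⟫ / ‖p‖ ^ 2) • q ∈ N} :=
      hN.preimage (by fun_prop)
    exact h1.inter h2
  have h1 : gauss (L ⊓ (ℝ ∙ u)ᗮ)ᗮ {y | ∃ n ∈ N, ∃ s : ℝ, 0 ≤ s ∧ n + s • u = y} =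
      ((gauss L).prod (gauss Lᗮ)) {x : Euc d × Euc d |
        0 ≤ ⟪x.1, p⟫ ∧ x.2 - (⟪x.1, p⟫ / ‖p‖ ^ 2) • q ∈ N} := by
    rw [← map_starProjection_gauss_top, ← map_add_gauss_prod L,
      Measure.map_map (by fun_prop) (by fun_prop), Measure.map_apply (by fun_prop) hm]
    refine measure_congr ?_
    have ha : ∀ᵐ x ∂(gauss L).prod (gauss Lᗮ), x.1 ∈ L :=
      Measure.quasiMeasurePreserving_fst.ae (ae_mem_gauss L)
    have hb : ∀ᵐ x ∂(gauss L).prod (gauss Lᗮ), x.2 ∈ Lᗮ :=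
      Measure.quasiMeasurePreserving_snd.ae (ae_mem_gauss Lᗮ)
    filter_upwards [ha, hb] with x hx1 hx2
    have hP1 : L.starProjection x.1 = x.1 := Submodule.starProjection_eq_self_iff.2 hx1
    have hP2 : L.starProjection x.2 = 0 := (L.starProjection_apply_eq_zero_iff).2 hx2
    have hQ2 : Lᗮ.starProjection x.2 = x.2 := Submodule.starProjection_eq_self_iff.2 hx2
    have hQp : Lᗮ.starProjection p = 0 :=
      (Lᗮ.starProjection_apply_eq_zero_iff).2 (L.le_orthogonal_orthogonal hpL)
    have hPp : L.starProjection p = p := Submodule.starProjection_eq_self_iff.2 hpL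
    have hx2p : ⟪x.2, p⟫ = 0 := by rw [real_inner_comm]; exact hx2 p hpL
    have hy : (L ⊓ (ℝ ∙ u)ᗮ)ᗮ.starProjection (x.1 + x.2) = x.2 + (⟪x.1, p⟫ / ‖p‖ ^ 2) • p := by
      rw [Submodule.starProjection_orthogonal_val, starProjection_inf_orthogonal, map_add, hP1, hP2,
        add_zero, rejection, ← hp]
      abel
    have hin : ⟪x.2 + (⟪x.1, p⟫ / ‖p‖ ^ 2) • p, p⟫ = ⟪x.1, p⟫ := by
      rw [inner_add_left, hx2p, real_inner_smul_left, real_inner_self_eq_norm_sq]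
      field_simp
      ring
    refine propext ?_
    change (∃ n ∈ N, ∃ s : ℝ, 0 ≤ s ∧ n + s • u =
      (L ⊓ (ℝ ∙ u)ᗮ)ᗮ.starProjection (x.1 + x.2)) ↔ _
    rw [mem_add_ray_iff hNL hu, hy, ← hp, ← hq, hin, map_add, map_add, map_smul, map_smul, hP2, hQ2,
      hPp, hQp]
    simp only [zero_add, smul_zero, add_zero, true_and]
    exact Iff.rfl
  rw [h1, Measure.prod_apply hS, rayProb]
  refine lintegral_congr fun a => ?_
  by_cases ha : 0 ≤ ⟪a, p⟫
  · rw [indicator_of_mem (by exact ha)]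
    congr 1; ext b; simp [ha]
  · rw [indicator_of_notMem (by exact ha)]
    simp [ha]

lemma measurable_rayProb {d : ℕ} (L : Submodule ℝ (Euc d)) {N : Set (Euc d)}
    (hN : MeasurableSet N) :
    Measurable fun x : Euc d × Euc d => rayProb L N x.1 x.2 := by
  unfold rayProb
  refine Measurable.lintegral_prod_right' (f := fun z : (Euc d × Euc d) × Euc d =>
    {a | 0 ≤ ⟪a, z.1.1⟫}.indicator
    (fun a => gauss Lᗮ {b | b - (⟪a, z.1.1⟫ / ‖z.1.1‖ ^ 2) • z.1.2 ∈ N}) z.2) ?_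
  have h1 : MeasurableSet {z : (Euc d × Euc d) × Euc d | 0 ≤ ⟪z.2, z.1.1⟫} :=
    measurableSet_le (by fun_prop) (by fun_prop)
  have h2 : MeasurableSet {z : ((Euc d × Euc d) × Euc d) × Euc d |
      z.2 - (⟪z.1.2, z.1.1.1⟫ / ‖z.1.1.1‖ ^ 2) • z.1.1.2 ∈ N} := hN.preimage (by fun_prop)
  exact (measurable_measure_prodMk_left (ν := gauss Lᗮ) h2).indicator h1

lemma rayProb_smul {d : ℕ} (L : Submodule ℝ (Euc d)) (N : Set (Euc d)) (p q : Euc d) {r : ℝ}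
    (hr : 0 < r) : rayProb L N (r • p) (r • q) = rayProb L N p q := by
  unfold rayProb
  refine lintegral_congr fun a => ?_
  have h : (⟪a, r • p⟫ / ‖r • p‖ ^ 2) • r • q = (⟪a, p⟫ / ‖p‖ ^ 2) • q := by
    rw [smul_smul, real_inner_smul_right, norm_smul, Real.norm_of_nonneg hr.le, mul_pow]
    congr 1
    field_simp
  have h' : 0 ≤ ⟪a, r • p⟫ ↔ 0 ≤ ⟪a, p⟫ := by
    rw [real_inner_smul_right, mul_nonneg_iff_of_pos_left hr]
  by_cases ha : 0 ≤ ⟪a, p⟫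
  · rw [indicator_of_mem (by exact h'.2 ha), indicator_of_mem (by exact ha), h]
  · rw [indicator_of_notMem (by exact fun h => ha (h'.1 h)), indicator_of_notMem (by exact ha)]

lemma rejection_smul {d : ℕ} (p a : Euc d) {r : ℝ} (hr : 0 < r) :
    rejection (r • p) a = rejection p a := by
  unfold rejection
  rw [smul_smul, real_inner_smul_right, norm_smul, Real.norm_of_nonneg hr.le, mul_pow]
  congr 2
  field_simp

lemma lintegral_rayProb {d : ℕ} {L : Submodule ℝ (Euc d)} {N : Set (Euc d)}
    (hN : MeasurableSet N) (hNc : IsConic N) {p : Euc d} (hp : p ∉ Lᗮ) :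
    ∫⁻ q, rayProb L N p q ∂(gauss Lᗮ) = 1 / 2 * gauss Lᗮ N := by
  unfold rayProb
  rw [lintegral_lintegral_swap]
  · have hH : MeasurableSet {a : Euc d | 0 ≤ ⟪a, p⟫} :=
      measurableSet_le (by fun_prop) (by fun_prop)
    have h : ∀ a, ∫⁻ q, {a | 0 ≤ ⟪a, p⟫}.indicator
        (fun a => gauss Lᗮ {b | b - (⟪a, p⟫ / ‖p‖ ^ 2) • q ∈ N}) a ∂(gauss Lᗮ) =
        {a | 0 ≤ ⟪a, p⟫}.indicator (fun _ => gauss Lᗮ N) a := by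
      intro a
      by_cases ha : a ∈ {a | 0 ≤ ⟪a, p⟫}
      · simp_rw [indicator_of_mem ha]
        rw [← gauss_prod_sub_smul_mem Lᗮ (⟪a, p⟫ / ‖p‖ ^ 2) hN hNc, Measure.prod_apply_symm]
        · rfl
        · exact hN.preimage (by fun_prop)
      · simp_rw [indicator_of_notMem ha]
        simp
    simp_rw [h]
    rw [lintegral_indicator hH, lintegral_const, Measure.restrict_apply_univ,
      gauss_closed_halfspace hp, mul_comm]
  · refine Measurable.aemeasurable ?_
    have h1 : MeasurableSet {z : Euc d × Euc d | 0 ≤ ⟪z.2, p⟫} :=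
      measurableSet_le (by fun_prop) (by fun_prop)
    have h2 : MeasurableSet {z : (Euc d × Euc d) × Euc d |
        z.2 - (⟪z.1.2, p⟫ / ‖p‖ ^ 2) • z.1.1 ∈ N} := hN.preimage (by fun_prop)
    exact (measurable_measure_prodMk_left (ν := gauss Lᗮ) h2).indicator h1

lemma isRotInvariantOn_map_rejection {d : ℕ} {L : Submodule ℝ (Euc d)}
    (hL : 2 ≤ Module.finrank ℝ L) :
    IsRotInvariantOn L
      (((gauss L).prod (gauss L)).map fun x : Euc d × Euc d => rejection x.1 x.2) := by
  refine ⟨?_, ?_, fun v hv => ?_⟩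
  · refine (ae_map_iff (p := fun x => x ∈ L) (by fun_prop)
      L.closed_of_finiteDimensional.measurableSet).2 ?_
    have ha : ∀ᵐ x ∂(gauss L).prod (gauss L), x.1 ∈ L :=
      Measure.quasiMeasurePreserving_fst.ae (ae_mem_gauss L)
    have hb : ∀ᵐ x ∂(gauss L).prod (gauss L), x.2 ∈ L :=
      Measure.quasiMeasurePreserving_snd.ae (ae_mem_gauss L)
    filter_upwards [ha, hb] with x h1 h2
    exact L.sub_mem h2 (L.smul_mem _ h1)
  · refine (ae_map_iff (p := fun x => x ≠ 0) (by fun_prop) (measurableSet_singleton 0).compl).2 ?_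
    rw [ae_iff]
    have hm : MeasurableSet {x : Euc d × Euc d | ¬ rejection x.1 x.2 ≠ 0} := by
      simp only [not_not]
      exact measurableSet_eq_fun (by fun_prop) (by fun_prop)
    rw [Measure.measure_prod_null hm]
    refine Filter.Eventually.of_forall fun p => ?_
    have hspan : ¬ L ≤ ℝ ∙ p := fun h => by
      have := (Submodule.finrank_mono h).trans (finrank_span_le_card ({p} : Set (Euc d)))
      simp only [toFinset_singleton, Finset.card_singleton] at this
      omega
    refine measure_mono_null (fun a ha => ?_) (gauss_submodule_eq_zero hspan)
    simp only [mem_preimage, mem_ofPred_eq, not_not, rejection, sub_eq_zero] at ha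
    rw [ha]
    exact Submodule.smul_mem _ _ (Submodule.mem_span_singleton_self p)
  · set ρ := (ℝ ∙ v)ᗮ.reflection with hρ
    have hmp : MeasurePreserving ρ (gauss L) (gauss L) :=
      ⟨by fun_prop, map_reflection_gauss L hv⟩
    conv_rhs => rw [← (hmp.prod hmp).map_eq]
    rw [Measure.map_map (by fun_prop) (by fun_prop), Measure.map_map (by fun_prop) (by fun_prop)]
    congr 1
    ext1 x
    simp [rejection, LinearIsometryEquiv.inner_map_map]

lemma lintegral_gauss_rejection {d : ℕ} {L : Submodule ℝ (Euc d)} (hL : 2 ≤ Module.finrank ℝ L)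
    {B : Set (Euc d)} (hB : MeasurableSet B) (hBc : IsConic B) :
    ∫⁻ p, gauss L {a | rejection p a ∈ B} ∂(gauss L) = gauss L B := by
  have hL0 : L ≠ ⊥ := by rintro rfl; simp at hL
  have := Measure.isProbabilityMeasure_map (μ := (gauss L).prod (gauss L))
    (f := fun x : Euc d × Euc d => rejection x.1 x.2) (by fun_prop)
  have h := (isRotInvariantOn_map_rejection hL).lintegral_eq (isRotInvariantOn_gauss hL0)
    (f := B.indicator 1) (measurable_one.indicator hB) (fun x r hr => by
      by_cases hx : x ∈ B
      · rw [indicator_of_mem hx, indicator_of_mem ((hBc.smul_mem_iff hr).2 hx)]; rfl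
      · rw [indicator_of_notMem hx, indicator_of_notMem (fun h => hx ((hBc.smul_mem_iff hr).1 h))])
  rw [lintegral_indicator_one hB, lintegral_indicator_one hB, Measure.map_apply (by fun_prop) hB,
    Measure.prod_apply (hB.preimage (by fun_prop))] at h
  exact h

lemma sphNormalized_preimage {d : ℕ} (hd : 1 ≤ d) {M : Set (Euc d)} (hM : MeasurableSet M)
    (hMc : IsConic M) : sphNormalized d {u | (u : Euc d) ∈ M} = gauss ⊤ M := by
  have h := lintegral_sphNormalized hd (f := M.indicator 1) (measurable_one.indicator hM)
    (fun x r hr => by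
      by_cases hx : x ∈ M
      · rw [indicator_of_mem hx, indicator_of_mem ((hMc.smul_mem_iff hr).2 hx)]; rfl
      · rw [indicator_of_notMem hx, indicator_of_notMem (fun h => hx ((hMc.smul_mem_iff hr).1 h))])
  rw [lintegral_indicator_one hM] at h
  rw [← h]
  exact (lintegral_indicator_one (hM.preimage measurable_subtype_coe)).symm

lemma ae_notMem_sphNormalized {d : ℕ} (hd : 1 ≤ d) {M : Submodule ℝ (Euc d)} (hM : M ≠ ⊤) :
    ∀ᵐ u : Metric.sphere (0 : Euc d) 1 ∂(sphNormalized d), (u : Euc d) ∉ M := by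
  have h := sphNormalized_preimage hd (M := (M : Set (Euc d)))
    M.closed_of_finiteDimensional.measurableSet (fun a ha r _ => M.smul_mem r ha)
  rw [gauss_submodule_eq_zero (by simpa using hM)] at h
  rw [ae_iff]
  simp only [not_not]
  exact h

/-- An everywhere measurable version of the expected curvature of the face `L ∩ u^⊥`, as a function
of `u`. -/
noncomputable def cutDensity {d : ℕ} (L : Submodule ℝ (Euc d)) (B N : Set (Euc d)) (u : Euc d) :
    ℝ≥0∞ :=
  gauss L {a | rejection (L.starProjection u) a ∈ B} *
    rayProb L N (L.starProjection u) (Lᗮ.starProjection u)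

lemma measurable_gauss_rejection {d : ℕ} (L : Submodule ℝ (Euc d)) {B : Set (Euc d)}
    (hB : MeasurableSet B) : Measurable fun p => gauss L {a | rejection p a ∈ B} :=
  measurable_measure_prodMk_left (ν := gauss L)
    (s := {z : Euc d × Euc d | rejection z.1 z.2 ∈ B}) (hB.preimage (by fun_prop))

lemma measurable_cutDensity {d : ℕ} (L : Submodule ℝ (Euc d)) {B N : Set (Euc d)}
    (hB : MeasurableSet B) (hN : MeasurableSet N) : Measurable (cutDensity L B N) := by
  have h1 : Measurable fun u : Euc d => L.starProjection u := L.starProjection.measurable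
  have h2 : Measurable fun u : Euc d => (L.starProjection u, Lᗮ.starProjection u) :=
    h1.prodMk Lᗮ.starProjection.measurable
  have h3 : Measurable fun u => gauss L {a | rejection (L.starProjection u) a ∈ B} :=
    (measurable_gauss_rejection L hB).comp h1
  have h4 := (measurable_rayProb L hN).comp h2
  unfold cutDensity
  exact h3.mul h4

lemma gauss_mul_gauss_eq_cutDensity {d : ℕ} {L : Submodule ℝ (Euc d)} {B N : Set (Euc d)}
    (hB : MeasurableSet B) (hN : MeasurableSet N) (hNL : N ⊆ Lᗮ) {u : Euc d} (hu : u ∉ Lᗮ) :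
    gauss (L ⊓ (ℝ ∙ u)ᗮ) B *
      gauss (L ⊓ (ℝ ∙ u)ᗮ)ᗮ {y | ∃ n ∈ N, ∃ s : ℝ, 0 ≤ s ∧ n + s • u = y} =
        cutDensity L B N u := by
  rw [gauss_inf_orthogonal L _ hB, gauss_inf_orthogonal_orthogonal hN hNL hu, cutDensity]

theorem lintegral_cutDensity {d : ℕ} {L : Submodule ℝ (Euc d)}
    (hL : 2 ≤ Module.finrank ℝ L) {B N : Set (Euc d)} (hB : MeasurableSet B) (hBc : IsConic B)
    (hN : MeasurableSet N) (hNc : IsConic N) :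
    ∫⁻ u : Metric.sphere (0 : Euc d) 1, cutDensity L B N u ∂(sphNormalized d) =
      1 / 2 * (gauss L B * gauss Lᗮ N) := by
  have hd : 1 ≤ d := by
    have := L.finrank_le
    rw [finrank_euclideanSpace_fin] at this
    omega
  have hL0 : L ≠ ⊥ := by rintro rfl; simp at hL
  have hg := measurable_gauss_rejection L hB
  have hr := measurable_rayProb L hN
  have hfm := measurable_cutDensity L hB hN
  calc _ = ∫⁻ u, cutDensity L B N u ∂(gauss ⊤) := lintegral_sphNormalized hd hfm fun x r hr => by
        simp only [cutDensity, map_smul, rejection_smul _ _ hr, rayProb_smul _ _ _ _ hr]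
    _ = ∫⁻ x, cutDensity L B N (x.1 + x.2) ∂((gauss L).prod (gauss Lᗮ)) := by
        rw [← map_add_gauss_prod L, lintegral_map hfm (by fun_prop)]
    _ = ∫⁻ x, gauss L {a | rejection x.1 a ∈ B} * rayProb L N x.1 x.2
          ∂((gauss L).prod (gauss Lᗮ)) := by
        refine lintegral_congr_ae ?_
        have ha : ∀ᵐ x ∂(gauss L).prod (gauss Lᗮ), x.1 ∈ L :=
          Measure.quasiMeasurePreserving_fst.ae (ae_mem_gauss L)
        have hb : ∀ᵐ x ∂(gauss L).prod (gauss Lᗮ), x.2 ∈ Lᗮ :=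
          Measure.quasiMeasurePreserving_snd.ae (ae_mem_gauss Lᗮ)
        filter_upwards [ha, hb] with x hx1 hx2
        have hP : L.starProjection (x.1 + x.2) = x.1 := by
          rw [map_add, Submodule.starProjection_eq_self_iff.2 hx1,
            (L.starProjection_apply_eq_zero_iff).2 hx2, add_zero]
        have hQ : Lᗮ.starProjection (x.1 + x.2) = x.2 := by
          rw [map_add, Submodule.starProjection_eq_self_iff.2 hx2,
            (Lᗮ.starProjection_apply_eq_zero_iff).2 (L.le_orthogonal_orthogonal hx1), zero_add]
        simp only [cutDensity, hP, hQ]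
    _ = ∫⁻ p, ∫⁻ q, gauss L {a | rejection p a ∈ B} * rayProb L N p q
          ∂(gauss Lᗮ) ∂(gauss L) :=
        lintegral_prod _ ((hg.comp measurable_fst).mul hr).aemeasurable
    _ = ∫⁻ p, gauss L {a | rejection p a ∈ B} * (1 / 2 * gauss Lᗮ N) ∂(gauss L) := by
        refine lintegral_congr_ae ?_
        filter_upwards [ae_mem_gauss L, (isRotInvariantOn_gauss hL0).ae_ne_zero] with p hp hp0
        have hrp := hr.comp (measurable_prodMk_left (x := p))
        simp only [Function.comp_def] at hrp
        rw [lintegral_const_mul _ hrp,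
          lintegral_rayProb hN hNc fun h => hp0 (inner_self_eq_zero.1 (h p hp))]
    _ = _ := by
        rw [lintegral_mul_const _ hg, lintegral_gauss_rejection hL hB hBc]
        ring

/-- The polyhedral cone cut out by the halfspaces with outer normals `u i`. -/
def polyCone {d : ℕ} {ι : Type*} (u : ι → Euc d) : Set (Euc d) := {x | ∀ i, ⟪u i, x⟫ ≤ 0}

/-- The intersection of the hyperplanes `(u i)^⊥` for which `s i` is `true`. -/
def flat {d : ℕ} {ι : Type*} (u : ι → Euc d) (s : ι → Bool) : Submodule ℝ (Euc d) where
  carrier := {x | ∀ i, s i = true → ⟪u i, x⟫ = 0}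
  zero_mem' := fun i _ => inner_zero_right _
  add_mem' := fun ha hb i hi => by rw [inner_add_right, ha i hi, hb i hi, add_zero]
  smul_mem' := fun c x hx i hi => by rw [real_inner_smul_right, hx i hi, mul_zero]

/-- The points of `polyCone u` at which exactly the constraints selected by `s` are active. -/
def stratum {d : ℕ} {ι : Type*} (u : ι → Euc d) (s : ι → Bool) : Set (Euc d) :=
  {x | x ∈ flat u s ∧ ∀ i, s i = false → ⟪u i, x⟫ < 0}

/-- The polar cone of a set. -/
def polar {d : ℕ} (C : Set (Euc d)) : Set (Euc d) := {v | ∀ y ∈ C, ⟪v, y⟫ ≤ 0}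

section

variable {d : ℕ} {ι : Type*} {u : ι → Euc d} {s : ι → Bool}

lemma mem_flat {x : Euc d} : x ∈ flat u s ↔ ∀ i, s i = true → ⟪u i, x⟫ = 0 := Iff.rfl

lemma stratum_subset_polyCone : stratum u s ⊆ polyCone u := fun x hx i => by
  cases h : s i
  · exact (hx.2 i h).le
  · exact (hx.1 i h).le

lemma measurableSet_stratum [Finite ι] : MeasurableSet (stratum u s) := by
  have h : stratum u s = (flat u s : Set (Euc d)) ∩ ⋂ i, {x | s i = false → ⟪u i, x⟫ < 0} := by
    ext x; simp [stratum]
  rw [h]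
  refine (flat u s).closed_of_finiteDimensional.measurableSet.inter
    (MeasurableSet.iInter fun i => ?_)
  cases s i
  · simpa using measurableSet_lt (by fun_prop) (by fun_prop)
  · simp

lemma isConic_stratum : IsConic (stratum u s) := fun a ha r hr =>
  ⟨(flat u s).smul_mem r ha.1, fun i hi => by
    rw [real_inner_smul_right]; exact mul_neg_of_pos_of_neg hr (ha.2 i hi)⟩

lemma isClosed_polar (C : Set (Euc d)) : IsClosed (polar C) := by
  simp only [polar, ofPred_forall]
  exact isClosed_iInter fun y => isClosed_iInter fun _ =>
    isClosed_le (by fun_prop) continuous_const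

lemma isConic_polar (C : Set (Euc d)) : IsConic (polar C) := fun a ha r hr y hy => by
  rw [real_inner_smul_left]; exact mul_nonpos_of_nonneg_of_nonpos hr.le (ha y hy)

lemma convex_polyCone : Convex ℝ (polyCone u) := fun x hx y hy a b ha hb _ i => by
  rw [inner_add_right, real_inner_smul_right, real_inner_smul_right]
  nlinarith [mul_nonneg ha (neg_nonneg.2 (hx i)), mul_nonneg hb (neg_nonneg.2 (hy i))]

lemma eventually_add_smul_lt [Finite ι] {x : Euc d} (hx : x ∈ stratum u s) (y : Euc d) :
    ∀ᶠ ε : ℝ in nhdsWithin 0 (Ioi 0), ∀ i, s i = false → ⟪u i, x + ε • y⟫ < 0 := by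
  refine Filter.Eventually.filter_mono nhdsWithin_le_nhds (Filter.eventually_all.2 fun i => ?_)
  by_cases h : s i = false
  · have hc : ContinuousAt (fun ε : ℝ => ⟪u i, x + ε • y⟫) 0 := by fun_prop
    filter_upwards [hc.eventually_lt (continuousAt_const (y := (0 : ℝ)))
      (by simpa using hx.2 i h)] with ε hε _ using hε
  · exact Filter.Eventually.of_forall fun ε h' => absurd h' h

lemma exists_add_smul_mem_polyCone [Finite ι] {x y : Euc d} (hx : x ∈ stratum u s)
    (hy : ∀ i, s i = true → ⟪u i, y⟫ ≤ 0) : ∃ ε : ℝ, 0 < ε ∧ x + ε • y ∈ polyCone u := by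
  obtain ⟨ε, h, hε⟩ := ((eventually_add_smul_lt hx y).and self_mem_nhdsWithin).exists
  refine ⟨ε, hε, fun i => ?_⟩
  cases hi : s i
  · exact (h i hi).le
  · rw [inner_add_right, hx.1 i hi, zero_add, real_inner_smul_right]
    exact mul_nonpos_of_nonneg_of_nonpos (le_of_lt hε) (hy i hi)

/-- A functional vanishing on the flat of `s` is nonpositive on the cone iff it is nonpositive on
the tangent cone at a point of the stratum of `s`. -/
lemma mem_polar_iff [Finite ι] {x v : Euc d} (hx : x ∈ stratum u s) (hv : v ∈ (flat u s)ᗮ) :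
    v ∈ polar (polyCone u) ↔ ∀ y, (∀ i, s i = true → ⟪u i, y⟫ ≤ 0) → ⟪v, y⟫ ≤ 0 := by
  refine ⟨fun h y hy => ?_, fun h y hy => h y fun i _ => hy i⟩
  obtain ⟨ε, hε, hm⟩ := exists_add_smul_mem_polyCone hx hy
  have h1 := h _ hm
  rw [inner_add_right, real_inner_comm, hv x hx.1, zero_add, real_inner_smul_right] at h1
  exact nonpos_of_mul_nonpos_right h1 hε

lemma isFace_polyCone_inter_flat (u : ι → Euc d) (s : ι → Bool) :
    IsFace (polyCone u) (polyCone u ∩ flat u s) := by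
  refine ⟨⟨inter_subset_left, fun x hx y hy z hz hzx => ⟨hx, fun i hi => ?_⟩⟩,
    convex_polyCone.inter (flat u s).convex, 0, fun i => (inner_zero_right _).le,
    (flat u s).zero_mem⟩
  obtain ⟨a, b, ha, hb, _, rfl⟩ := hzx
  have h := hz.2 i hi
  rw [inner_add_right, real_inner_smul_right, real_inner_smul_right] at h
  nlinarith [hx i, hy i, mul_nonneg hb.le (neg_nonneg.2 (hy i)),
    mul_nonneg ha.le (neg_nonneg.2 (hx i))]

lemma linHull_polyCone_inter_flat [Finite ι] (h : (stratum u s).Nonempty) :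
    linHull (polyCone u ∩ flat u s) = flat u s := by
  refine le_antisymm (Submodule.span_le.2 inter_subset_right) fun y hy => ?_
  obtain ⟨x, hx⟩ := h
  obtain ⟨ε, hε, hm⟩ := exists_add_smul_mem_polyCone hx (y := y) fun i hi => (hy i hi).le
  have h1 : x + ε • y ∈ linHull (polyCone u ∩ flat u s) := Submodule.subset_span
    ⟨hm, (flat u s).add_mem hx.1 ((flat u s).smul_mem ε hy)⟩
  have h2 : x ∈ linHull (polyCone u ∩ flat u s) := Submodule.subset_span
    ⟨stratum_subset_polyCone hx, hx.1⟩
  have h3 := Submodule.smul_mem _ ε⁻¹ (Submodule.sub_mem _ h1 h2)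
  rwa [add_sub_cancel_left, inv_smul_smul₀ hε.ne'] at h3

lemma eq_true_iff_of_stratum_nonempty (h : (stratum u s).Nonempty) (i : ι) :
    s i = true ↔ ∀ x ∈ polyCone u ∩ flat u s, ⟪u i, x⟫ = 0 := by
  refine ⟨fun hi x hx => hx.2 i hi, fun hi => ?_⟩
  obtain ⟨x, hx⟩ := h
  by_contra hs
  exact (hx.2 i (by simpa using hs)).ne (hi x ⟨stratum_subset_polyCone hx, hx.1⟩)

lemma exists_eq_polyCone_inter_flat [Finite ι] {F : Set (Euc d)} (hF : IsFace (polyCone u) F) :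
    ∃ s, (stratum u s).Nonempty ∧ F = polyCone u ∩ flat u s := by
  classical
  cases nonempty_fintype ι
  obtain ⟨hext, hconv, x₁, hx₁⟩ := hF
  set s : ι → Bool := fun i => decide (∀ x ∈ F, ⟪u i, x⟫ = 0) with hs
  have hsub : F ⊆ polyCone u ∩ flat u s := fun x hx =>
    ⟨hext.subset hx, fun i hi => of_decide_eq_true hi x hx⟩
  have hint : ∀ T : Finset ι, ∃ x ∈ F, ∀ i ∈ T, s i = false → ⟪u i, x⟫ < 0 := by
    intro T
    induction T using Finset.induction_on with
    | empty => exact ⟨x₁, hx₁, by simp⟩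
    | insert j T _ ih =>
      obtain ⟨x, hx, hxT⟩ := ih
      by_cases hj : s j = false
      · obtain ⟨y, hy, hyj⟩ : ∃ y ∈ F, ⟪u j, y⟫ ≠ 0 := by
          simpa using of_decide_eq_false hj
        refine ⟨(1 / 2 : ℝ) • x + (1 / 2 : ℝ) • y,
          hconv hx hy (by norm_num) (by norm_num) (by norm_num), fun i hi hsi => ?_⟩
        rw [inner_add_right, real_inner_smul_right, real_inner_smul_right]
        have h1 := hext.subset hx i
        have h2 := hext.subset hy i
        rcases Finset.mem_insert.1 hi with rfl | hi
        · have := lt_of_le_of_ne h2 hyj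
          linarith
        · have := hxT i hi hsi
          linarith
      · refine ⟨x, hx, fun i hi hsi => ?_⟩
        rcases Finset.mem_insert.1 hi with rfl | hi
        · exact absurd hsi hj
        · exact hxT i hi hsi
  obtain ⟨x, hx, hxs⟩ := hint Finset.univ
  have hxs' : x ∈ stratum u s := ⟨(hsub hx).2, fun i => hxs i (Finset.mem_univ i)⟩
  refine ⟨s, ⟨x, hxs'⟩, hsub.antisymm fun y hy => ?_⟩
  obtain ⟨ε, hε, hm⟩ := exists_add_smul_mem_polyCone hxs' (y := x - y) fun i hi => by
    rw [inner_sub_right, hxs'.1 i hi, hy.2 i hi, sub_zero]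
  refine hext.left_mem_of_mem_openSegment hy.1 hm hx
    ⟨ε / (1 + ε), 1 / (1 + ε), by positivity, by positivity, by field_simp; ring, ?_⟩
  have h1 : (1 + ε) ≠ 0 := by positivity
  have h2 : ε • y + (x + ε • (x - y)) = (1 + ε) • x := by module
  rw [div_eq_inv_mul, div_eq_inv_mul, mul_one, mul_smul, ← smul_add, h2, inv_smul_smul₀ h1]

lemma gauss_polyCone_inter_flat [Finite ι] (h : (stratum u s).Nonempty) (A : Set (Euc d)) :
    gauss (flat u s) (polyCone u ∩ flat u s ∩ A) = gauss (flat u s) (stratum u s ∩ A) := by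
  obtain ⟨x, hx⟩ := h
  have hne : ∀ᵐ y ∂gauss (flat u s), ∀ i, s i = false → ⟪u i, y⟫ ≠ 0 := by
    refine ae_all_iff.2 fun i => ?_
    by_cases hi : s i = false
    · have hle : ¬ flat u s ≤ (ℝ ∙ u i)ᗮ := fun hle => (hx.2 i hi).ne
        (Submodule.mem_orthogonal_singleton_iff_inner_right.1 (hle hx.1))
      filter_upwards [ae_notMem_gauss hle] with y hy _ h0
      exact hy (Submodule.mem_orthogonal_singleton_iff_inner_right.2 h0)
    · exact Filter.Eventually.of_forall fun y h' => absurd h' hi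
  refine measure_congr ?_
  filter_upwards [hne] with y hy
  refine propext ⟨fun h => ⟨⟨h.1.2, fun i hi => lt_of_le_of_ne (h.1.1 i) (hy i hi)⟩, h.2⟩,
    fun h => ⟨⟨stratum_subset_polyCone h.1, h.1.1⟩, h.2⟩⟩

lemma gauss_normalCone_polyCone_inter_flat :
    gauss (flat u s)ᗮ (normalCone (polyCone u) (polyCone u ∩ flat u s)) =
      gauss (flat u s)ᗮ (polar (polyCone u)) := by
  refine measure_congr ?_
  filter_upwards [ae_mem_gauss (flat u s)ᗮ] with v hv
  exact propext ⟨fun h => h.1, fun h => ⟨h, fun x hx => by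
    rw [real_inner_comm]; exact hv x hx.2⟩⟩

theorem Phi_polyCone [Fintype ι] [DecidableEq ι] (u : ι → Euc d) (k : ℕ) (A : Set (Euc d)) :
    Phi k (polyCone u) A = ∑ s : ι → Bool, if Module.finrank ℝ (flat u s) = k then
      gauss (flat u s) (stratum u s ∩ A) * gauss (flat u s)ᗮ (polar (polyCone u)) else 0 := by
  set S : Set (ι → Bool) := {s | (stratum u s).Nonempty ∧ Module.finrank ℝ (flat u s) = k} with hS
  let e : S → {F : Set (Euc d) // IsFaceDim (polyCone u) F k} := fun s =>
    ⟨polyCone u ∩ flat u s.1, isFace_polyCone_inter_flat u s.1, by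
      rw [dimS, linHull_polyCone_inter_flat s.2.1, s.2.2]⟩
  have he : Function.Bijective e := by
    refine ⟨fun s t hst => Subtype.ext (funext fun i => Bool.eq_iff_iff.2 ?_), fun F => ?_⟩
    · have h : polyCone u ∩ flat u s.1 = polyCone u ∩ flat u t.1 := congrArg Subtype.val hst
      rw [eq_true_iff_of_stratum_nonempty s.2.1, eq_true_iff_of_stratum_nonempty t.2.1, h]
    · obtain ⟨s, hs, hF⟩ := exists_eq_polyCone_inter_flat F.2.1
      refine ⟨⟨s, hs, ?_⟩, Subtype.ext hF.symm⟩
      rw [← F.2.2, dimS, hF, linHull_polyCone_inter_flat hs]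
  rw [Phi, ← (Equiv.ofBijective e he).tsum_eq]
  have hterm : ∀ s : S, gauss (linHull (polyCone u ∩ flat u s.1)) (polyCone u ∩ flat u s.1 ∩ A) *
      gauss (linHull (polyCone u ∩ flat u s.1))ᗮ
        (normalCone (polyCone u) (polyCone u ∩ flat u s.1)) =
      gauss (flat u s.1) (stratum u s.1 ∩ A) * gauss (flat u s.1)ᗮ (polar (polyCone u)) :=
    fun s => by
      rw [linHull_polyCone_inter_flat s.2.1, gauss_polyCone_inter_flat s.2.1,
        gauss_normalCone_polyCone_inter_flat]
  refine (tsum_congr hterm).trans ?_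
  rw [tsum_subtype S fun s => gauss (flat u s) (stratum u s ∩ A) *
    gauss (flat u s)ᗮ (polar (polyCone u)), tsum_fintype]
  refine Finset.sum_congr rfl fun s _ => ?_
  by_cases hk : Module.finrank ℝ (flat u s) = k
  · rw [if_pos hk]
    by_cases hs : (stratum u s).Nonempty
    · exact indicator_of_mem (show s ∈ S from ⟨hs, hk⟩) _
    · rw [indicator_of_notMem fun h : s ∈ S => hs h.1, not_nonempty_iff_eq_empty.1 hs]
      simp
  · rw [if_neg hk, indicator_of_notMem fun h : s ∈ S => hk h.2]

end

/-- The family of normals `u` extended by one further normal `w`. -/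
def consNormal {d : ℕ} {ι : Type*} (w : Euc d) (u : ι → Euc d) (o : Option ι) : Euc d := o.elim w u

section

variable {d : ℕ} {ι : Type*} {u : ι → Euc d} {s : ι → Bool} {w : Euc d}

lemma polyCone_consNormal :
    polyCone (consNormal w u) = polyCone u ∩ {x | ⟪w, x⟫ ≤ 0} := by
  ext x
  simp [polyCone, consNormal, Option.forall, and_comm]

lemma flat_consNormal_false :
    flat (consNormal w u) ((Equiv.piOptionEquivProd (β := fun _ => Bool)).symm (false, s)) =
      flat u s := by
  ext x
  simp [mem_flat, consNormal, Option.forall, Equiv.piOptionEquivProd]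

lemma flat_consNormal_true :
    flat (consNormal w u) ((Equiv.piOptionEquivProd (β := fun _ => Bool)).symm (true, s)) =
      flat u s ⊓ (ℝ ∙ w)ᗮ := by
  ext x
  simp [mem_flat, consNormal, Option.forall, Equiv.piOptionEquivProd,
    Submodule.mem_orthogonal_singleton_iff_inner_right, and_comm]

lemma stratum_consNormal_false :
    stratum (consNormal w u) ((Equiv.piOptionEquivProd (β := fun _ => Bool)).symm (false, s)) =
      stratum u s ∩ {x | ⟪w, x⟫ < 0} := by
  ext x
  simp only [stratum, flat_consNormal_false, mem_ofPred_eq, Option.forall, mem_inter_iff]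
  simp only [consNormal, Equiv.piOptionEquivProd]
  simp
  tauto

lemma stratum_consNormal_true :
    stratum (consNormal w u) ((Equiv.piOptionEquivProd (β := fun _ => Bool)).symm (true, s)) =
      stratum u s ∩ (ℝ ∙ w)ᗮ := by
  ext x
  simp only [stratum, flat_consNormal_true, mem_ofPred_eq, Option.forall, mem_inter_iff]
  simp only [consNormal, Equiv.piOptionEquivProd]
  simp
  tauto

lemma mem_polar_consNormal_false_iff [Finite ι] {x v : Euc d} (hx : x ∈ stratum u s)
    (hwx : ⟪w, x⟫ < 0) (hv : v ∈ (flat u s)ᗮ) :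
    v ∈ polar (polyCone (consNormal w u)) ↔ v ∈ polar (polyCone u) := by
  have hx' : x ∈ stratum (consNormal w u)
      ((Equiv.piOptionEquivProd (β := fun _ => Bool)).symm (false, s)) := by
    rw [stratum_consNormal_false]; exact ⟨hx, hwx⟩
  rw [mem_polar_iff hx' (by rwa [flat_consNormal_false]), mem_polar_iff hx hv]
  simp [consNormal, Option.forall, Equiv.piOptionEquivProd]

lemma exists_mem_inner_eq_one {L : Submodule ℝ (Euc d)} (hw : w ∉ Lᗮ) :
    ∃ z ∈ L, ⟪w, z⟫ = 1 := by
  obtain ⟨z, hz, hwz⟩ : ∃ z ∈ L, ⟪z, w⟫ ≠ 0 := by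
    simpa [Submodule.mem_orthogonal] using hw
  exact ⟨⟪z, w⟫⁻¹ • z, L.smul_mem _ hz, by
    rw [real_inner_smul_right, real_inner_comm z w, inv_mul_cancel₀ hwz]⟩

lemma mem_polar_consNormal_true_iff [Finite ι] {x v : Euc d} (hx : x ∈ stratum u s)
    (hwx : ⟪w, x⟫ = 0) (hw : w ∉ (flat u s)ᗮ) (hv : v ∈ (flat u s ⊓ (ℝ ∙ w)ᗮ)ᗮ) :
    v ∈ polar (polyCone (consNormal w u)) ↔
      ∃ n ∈ polar (polyCone u) ∩ (flat u s)ᗮ, ∃ r : ℝ, 0 ≤ r ∧ n + r • w = v := by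
  constructor
  · intro h
    obtain ⟨z, hz, hwz⟩ := exists_mem_inner_eq_one hw
    have hx' : x ∈ stratum (consNormal w u)
        ((Equiv.piOptionEquivProd (β := fun _ => Bool)).symm (true, s)) := by
      rw [stratum_consNormal_true]
      exact ⟨hx, Submodule.mem_orthogonal_singleton_iff_inner_right.2 hwx⟩
    have hT : ∀ y, (∀ i, s i = true → ⟪u i, y⟫ ≤ 0) → ⟪w, y⟫ ≤ 0 → ⟪v, y⟫ ≤ 0 := fun y hy hwy =>
      (mem_polar_iff hx' (by rwa [flat_consNormal_true])).1 h y fun o ho => by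
        cases o with
        | none => exact hwy
        | some i => exact hy i ho
    have hr : 0 ≤ ⟪v, z⟫ := by
      have := hT (-z) (fun i hi => by rw [inner_neg_right, hz i hi, neg_zero])
        (by rw [inner_neg_right, hwz]; norm_num)
      rw [inner_neg_right] at this
      linarith
    have hn : v - ⟪v, z⟫ • w ∈ (flat u s)ᗮ := fun y hy => by
      have hm : y - ⟪w, y⟫ • z ∈ flat u s ⊓ (ℝ ∙ w)ᗮ :=
        ⟨(flat u s).sub_mem hy ((flat u s).smul_mem _ hz),
          Submodule.mem_orthogonal_singleton_iff_inner_right.2 (by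
            rw [inner_sub_right, real_inner_smul_right, hwz]; ring)⟩
      have := hv _ hm
      rw [inner_sub_left, real_inner_smul_left, real_inner_comm, real_inner_comm v z] at this
      rw [real_inner_comm, inner_sub_left, real_inner_smul_left]
      linarith
    refine ⟨v - ⟪v, z⟫ • w, ⟨(mem_polar_iff hx hn).2 fun y hy => ?_, hn⟩, ⟪v, z⟫, hr, by abel⟩
    have := hT (y - ⟪w, y⟫ • z) (fun i hi => by
      rw [inner_sub_right, real_inner_smul_right, hz i hi, mul_zero, sub_zero]; exact hy i hi)
      (by rw [inner_sub_right, real_inner_smul_right, hwz]; linarith)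
    rw [inner_sub_right, real_inner_smul_right] at this
    rw [inner_sub_left, real_inner_smul_left]
    linarith
  · rintro ⟨n, hn, r, hr, rfl⟩ y hy
    rw [polyCone_consNormal] at hy
    rw [inner_add_left, real_inner_smul_left]
    have h1 := hn.1 y hy.1
    have h2 := mul_nonpos_of_nonneg_of_nonpos hr hy.2
    linarith

lemma finrank_inf_orthogonal {L : Submodule ℝ (Euc d)} (hw : w ∉ Lᗮ) :
    Module.finrank ℝ (L ⊓ (ℝ ∙ w)ᗮ : Submodule ℝ (Euc d)) + 1 = Module.finrank ℝ L := by
  have hw0 : w ≠ 0 := fun h => hw (h ▸ Lᗮ.zero_mem)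
  have hsup : L ⊔ (ℝ ∙ w)ᗮ = ⊤ := by
    obtain ⟨z, hz, hwz⟩ := exists_mem_inner_eq_one hw
    refine eq_top_iff.2 fun y _ => Submodule.mem_sup.2
      ⟨⟪w, y⟫ • z, L.smul_mem _ hz, y - ⟪w, y⟫ • z,
        Submodule.mem_orthogonal_singleton_iff_inner_right.2 ?_, by abel⟩
    rw [inner_sub_right, real_inner_smul_right, hwz]
    ring
  have h1 := Submodule.finrank_sup_add_finrank_inf_eq L (ℝ ∙ w)ᗮ
  have h2 := Submodule.finrank_add_finrank_orthogonal (ℝ ∙ w)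
  rw [finrank_span_singleton hw0] at h2
  rw [hsup, finrank_top] at h1
  omega

lemma gauss_stratum_consNormal_false [Finite ι] (A : Set (Euc d)) :
    gauss (flat u s) (stratum u s ∩ {x | ⟪w, x⟫ < 0} ∩ A) *
        gauss (flat u s)ᗮ (polar (polyCone (consNormal w u))) =
      gauss (flat u s) (stratum u s ∩ A ∩ {x | ⟪w, x⟫ < 0}) *
        gauss (flat u s)ᗮ (polar (polyCone u)) := by
  rw [inter_right_comm]
  rcases (stratum u s ∩ A ∩ {x | ⟪w, x⟫ < 0}).eq_empty_or_nonempty with h | ⟨x, hx⟩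
  · simp [h]
  · congr 1
    refine measure_congr ?_
    filter_upwards [ae_mem_gauss (flat u s)ᗮ] with v hv
    exact propext (mem_polar_consNormal_false_iff hx.1.1 hx.2 hv)

lemma gauss_inter_self (L : Submodule ℝ (Euc d)) (S : Set (Euc d)) :
    gauss L (S ∩ L) = gauss L S := by
  refine measure_congr ?_
  filter_upwards [ae_mem_gauss L] with x hx
  exact propext ⟨fun h => h.1, fun h => ⟨h, hx⟩⟩

lemma gauss_stratum_consNormal_true [Finite ι] {A : Set (Euc d)} (hA : MeasurableSet A)
    (hw : w ∉ (flat u s)ᗮ) :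
    gauss (flat u s ⊓ (ℝ ∙ w)ᗮ) (stratum u s ∩ (ℝ ∙ w)ᗮ ∩ A) *
        gauss (flat u s ⊓ (ℝ ∙ w)ᗮ)ᗮ (polar (polyCone (consNormal w u))) =
      cutDensity (flat u s) (stratum u s ∩ A) (polar (polyCone u) ∩ (flat u s)ᗮ) w := by
  rw [← gauss_mul_gauss_eq_cutDensity (measurableSet_stratum.inter hA)
    ((isClosed_polar _).measurableSet.inter
      (flat u s)ᗮ.closed_of_finiteDimensional.measurableSet) inter_subset_right hw]
  have h1 : gauss (flat u s ⊓ (ℝ ∙ w)ᗮ) (stratum u s ∩ (ℝ ∙ w)ᗮ ∩ A) =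
      gauss (flat u s ⊓ (ℝ ∙ w)ᗮ) (stratum u s ∩ A) := by
    refine measure_congr ?_
    filter_upwards [ae_mem_gauss (flat u s ⊓ (ℝ ∙ w)ᗮ)] with x hx
    exact propext ⟨fun h => ⟨h.1.1, h.2⟩, fun h => ⟨⟨h.1, hx.2⟩, h.2⟩⟩
  rcases (stratum u s ∩ (ℝ ∙ w)ᗮ ∩ A).eq_empty_or_nonempty with h | ⟨x, hx⟩
  · rw [← h1, h]; simp
  · rw [h1]
    congr 1
    refine measure_congr ?_
    filter_upwards [ae_mem_gauss (flat u s ⊓ (ℝ ∙ w)ᗮ)ᗮ] with v hv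
    exact propext (mem_polar_consNormal_true_iff hx.1.1
      (Submodule.mem_orthogonal_singleton_iff_inner_right.1 hx.1.2) hw hv)

theorem Phi_polyCone_inter_halfspace [Fintype ι] [DecidableEq ι] {A : Set (Euc d)}
    (hA : MeasurableSet A) {k : ℕ} (hk : 1 ≤ k) (hw : ∀ s, flat u s ≠ ⊥ → w ∉ (flat u s)ᗮ) :
    Phi k (polyCone u ∩ {x | ⟪w, x⟫ ≤ 0}) A =
      ∑ s : ι → Bool, (if Module.finrank ℝ (flat u s) = k + 1 then
          cutDensity (flat u s) (stratum u s ∩ A) (polar (polyCone u) ∩ (flat u s)ᗮ) w else 0) +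
        ∑ s : ι → Bool, if Module.finrank ℝ (flat u s) = k then
          gauss (flat u s) (stratum u s ∩ A ∩ {x | ⟪w, x⟫ < 0}) *
            gauss (flat u s)ᗮ (polar (polyCone u)) else 0 := by
  rw [← polyCone_consNormal, Phi_polyCone,
    ← (Equiv.piOptionEquivProd (β := fun _ => Bool)).symm.sum_comp, Fintype.sum_prod_type,
    Fintype.sum_bool]
  congr 1 <;> refine Finset.sum_congr rfl fun s _ => ?_
  · rw [flat_consNormal_true, stratum_consNormal_true]
    by_cases h0 : flat u s = ⊥
    · have h1 : Module.finrank ℝ (flat u s ⊓ (ℝ ∙ w)ᗮ : Submodule ℝ (Euc d)) = 0 := by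
        rw [h0, bot_inf_eq, finrank_bot]
      rw [if_neg (by omega), if_neg (by rw [h0, finrank_bot]; omega)]
    · have h1 := finrank_inf_orthogonal (hw s h0)
      by_cases h2 : Module.finrank ℝ (flat u s) = k + 1
      · rw [if_pos h2, if_pos (by omega), gauss_stratum_consNormal_true hA (hw s h0)]
      · rw [if_neg h2, if_neg (by omega)]
  · rw [flat_consNormal_false, stratum_consNormal_false, gauss_stratum_consNormal_false]

lemma measurable_gauss_inter_halfspace (L : Submodule ℝ (Euc d)) {S : Set (Euc d)}
    (hS : MeasurableSet S) : Measurable fun w => gauss L (S ∩ {x | ⟪w, x⟫ < 0}) := by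
  have h : MeasurableSet {z : Euc d × Euc d | ⟪z.1, z.2⟫ < 0} :=
    measurableSet_lt (by fun_prop) (by fun_prop)
  exact measurable_measure_prodMk_left (ν := gauss L) ((hS.preimage measurable_snd).inter h)

lemma lintegral_gauss_inter_halfspace (hd : 1 ≤ d) {L : Submodule ℝ (Euc d)} (hL : L ≠ ⊥)
    {S : Set (Euc d)} (hS : MeasurableSet S) :
    ∫⁻ w : Metric.sphere (0 : Euc d) 1, gauss L (S ∩ {x | ⟪(w : Euc d), x⟫ < 0})
      ∂(sphNormalized d) = 1 / 2 * gauss L S := by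
  have h : MeasurableSet {z : Euc d × Euc d | z.2 ∈ S ∧ ⟪z.1, z.2⟫ < 0} :=
    (hS.preimage measurable_snd).inter
      (show MeasurableSet {z : Euc d × Euc d | ⟪z.1, z.2⟫ < 0} from
        measurableSet_lt (by fun_prop) (by fun_prop))
  rw [lintegral_sphNormalized hd (f := fun w => gauss L (S ∩ {x | ⟪w, x⟫ < 0}))
    (measurable_gauss_inter_halfspace L hS) fun w r hr => by
      congr 2; ext x
      simp only [mem_ofPred_eq, real_inner_smul_left]
      exact smul_neg_iff_of_pos_left hr]
  have h1 := Measure.prod_apply (μ := gauss ⊤) (ν := gauss L) h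
  have h2 := Measure.prod_apply_symm (μ := gauss ⊤) (ν := gauss L) h
  refine (h1.symm.trans h2).trans ?_
  have h3 : ∀ᵐ x ∂gauss L, gauss ⊤ ((fun w => (w, x)) ⁻¹'
      {z : Euc d × Euc d | z.2 ∈ S ∧ ⟪z.1, z.2⟫ < 0}) = S.indicator (fun _ => 1 / 2) x := by
    filter_upwards [(isRotInvariantOn_gauss hL).ae_ne_zero] with x hx
    by_cases hxS : x ∈ S
    · rw [indicator_of_mem hxS, ← gauss_halfspace (L := ⊤) (p := x) (by simpa using hx)]
      congr 1; ext w; simp [hxS]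
    · rw [indicator_of_notMem hxS]
      simp [hxS]
  rw [lintegral_congr_ae h3, lintegral_indicator hS, lintegral_const,
    Measure.restrict_apply_univ]

end

/-- For a polyhedral cone `C ⊆ ℝ^d`, a conic Borel set `A` and `k ∈ {1,…,d}`:
`∫_{𝕊^{d−1}} Φ_k(C ∩ u⁻, A) σ(du) = (1/2) Φ_k(C,A) + (1/2) Φ_{k+1}(C,A)`,
where `u⁻ = {x : ⟪x,u⟫ ≤ 0}` and `σ` is the normalized spherical Lebesgue measure
(for `k = d` the second summand `Φ_{d+1}(C,A)` vanishes). -/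
theorem integral_curvature_halfspace_cut {d : ℕ} (C A : Set (Euc d))
    (hC : IsPolyCone C) (hA : MeasurableSet A) (hAc : IsConic A)
    (k : ℕ) (hk1 : 1 ≤ k) (hkd : k ≤ d) :
    ∫⁻ u : Metric.sphere (0 : Euc d) 1,
        Phi k (C ∩ {x : Euc d | ⟪(u : Euc d), x⟫ ≤ 0}) A ∂(sphNormalized d)
      = 1 / 2 * Phi k C A + 1 / 2 * Phi (k + 1) C A := by
  classical
  obtain ⟨U, rfl⟩ := hC
  have hd : 1 ≤ d := hk1.trans hkd
  set u : U → Euc d := Subtype.val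
  have hCu : ⋂ v ∈ U, {x : Euc d | ⟪v, x⟫ ≤ 0} = polyCone u := by
    ext x; simp [polyCone, u]
  have hB : ∀ s, MeasurableSet (stratum u s ∩ A) := fun s => measurableSet_stratum.inter hA
  have hBc : ∀ s, IsConic (stratum u s ∩ A) := fun s a ha r hr =>
    ⟨isConic_stratum a ha.1 r hr, hAc a ha.2 r hr⟩
  have hN : ∀ s, MeasurableSet (polar (polyCone u) ∩ (flat u s)ᗮ) := fun s =>
    (isClosed_polar _).measurableSet.inter
      (flat u s)ᗮ.closed_of_finiteDimensional.measurableSet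
  have hNc : ∀ s, IsConic (polar (polyCone u) ∩ (flat u s)ᗮ) := fun s a ha r hr =>
    ⟨isConic_polar _ a ha.1 r hr, (flat u s)ᗮ.smul_mem r ha.2⟩
  have hae : ∀ᵐ w : Metric.sphere (0 : Euc d) 1 ∂(sphNormalized d),
      ∀ s, flat u s ≠ ⊥ → (w : Euc d) ∉ (flat u s)ᗮ := by
    refine ae_all_iff.2 fun s => ?_
    by_cases h : flat u s = ⊥
    · exact Filter.Eventually.of_forall fun w h' => absurd h h'
    · filter_upwards [ae_notMem_sphNormalized hd (M := (flat u s)ᗮ)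
        (by simpa [Submodule.orthogonal_eq_top_iff] using h)] with w hw _ using hw
  have hm : ∀ s : U → Bool, Measurable fun w : Metric.sphere (0 : Euc d) 1 =>
      if Module.finrank ℝ (flat u s) = k + 1 then
        cutDensity (flat u s) (stratum u s ∩ A) (polar (polyCone u) ∩ (flat u s)ᗮ) w else 0 :=
    fun s => by
      by_cases h : Module.finrank ℝ (flat u s) = k + 1
      · simp only [if_pos h]
        exact (measurable_cutDensity (flat u s) (hB s) (hN s)).comp measurable_subtype_coe
      · simp only [if_neg h]
        exact measurable_const
  have hm' : ∀ s : U → Bool, Measurable fun w : Metric.sphere (0 : Euc d) 1 =>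
      if Module.finrank ℝ (flat u s) = k then
        gauss (flat u s) (stratum u s ∩ A ∩ {x | ⟪(w : Euc d), x⟫ < 0}) *
          gauss (flat u s)ᗮ (polar (polyCone u)) else 0 :=
    fun s => by
      by_cases h : Module.finrank ℝ (flat u s) = k
      · simp only [if_pos h]
        exact ((measurable_gauss_inter_halfspace (flat u s) (hB s)).comp
          measurable_subtype_coe).mul_const _
      · simp only [if_neg h]
        exact measurable_const
  rw [hCu, lintegral_congr_ae (hae.mono fun w hw => Phi_polyCone_inter_halfspace hA hk1 hw),
    lintegral_add_left (Finset.measurable_fun_sum _ fun s _ => hm s),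
    lintegral_finsetSum _ fun s _ => hm s, lintegral_finsetSum _ fun s _ => hm' s,
    Phi_polyCone, Phi_polyCone, Finset.mul_sum, Finset.mul_sum, add_comm]
  congr 1 <;> refine Finset.sum_congr rfl fun s _ => ?_
  · by_cases h : Module.finrank ℝ (flat u s) = k
    · have h0 : flat u s ≠ ⊥ := fun h0 => by rw [h0, finrank_bot] at h; omega
      simp only [if_pos h]
      have hms := (measurable_gauss_inter_halfspace (flat u s) (hB s)).comp
        (measurable_subtype_coe (p := fun w : Euc d => w ∈ Metric.sphere 0 1))
      simp only [Function.comp_def] at hms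
      rw [lintegral_mul_const _ hms, lintegral_gauss_inter_halfspace hd h0 (hB s), mul_assoc]
    · simp [if_neg h]
  · by_cases h : Module.finrank ℝ (flat u s) = k + 1
    · simp only [if_pos h]
      rw [lintegral_cutDensity (by omega) (hB s) (hBc s) (hN s) (hNc s), gauss_inter_self]
    · simp [if_neg h]
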